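/- arXiv:1110.0780 — 4 statements merged into one kernel-verified Lean document; each statement's English description precedes it below -/
import Mathlib

section
/- Let k, n ≥ 1, let B : ℤ^k → GL(n,ℤ) be a group homomorphism such that for every nonzero a ∈ ℤ^k no complex eigenvalue of B(a) is a root of unity, and let v : ℤ^k → ℝ^n be any map; for a ∈ ℤ^k let τ(a) : ℝ^n → ℝ^n be the affine map τ(a)x = B(a)·x + v(a). Fix θ with 0 < θ < 1. Then there exist r > 1 and C > 0 such that for every a ∈ ℤ^k and all ℤ^n-periodic θ-Hölder functions f, g : ℝ^n → ℝ, | ∫_{[0,1]^n} f(τ(a)x) g(x) dx − (∫_{[0,1]^n} f(x) dx)·(∫_{[0,1]^n} g(x) dx) | ≤ C · ( ‖f‖_θ ‖g‖_{L²} + ‖g‖_θ ‖f‖_{L²} ) · r^{−θ‖a‖}, where ‖·‖_{L²} is the L² norm on [0,1]^n with Lebesgue measure and ‖a‖ is the Euclidean norm on ℤ^k. In particular the matrix coefficients decay exponentially in ‖a‖. -/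
open MeasureTheory

/-- The Euclidean norm of an integer vector. -/
noncomputable def latticeNorm {k : ℕ} (a : Fin k → ℤ) : ℝ := Real.sqrt (∑ j, (a j : ℝ) ^ 2)

lemma latticeNorm_neg {k : ℕ} (a : Fin k → ℤ) : latticeNorm (-a) = latticeNorm a := by
  simp [latticeNorm]

lemma latticeNorm_le {k : ℕ} (a : Fin k → ℤ) :
    latticeNorm a ≤ Real.sqrt k * ‖fun j => (a j : ℝ)‖ := by
  rw [latticeNorm, ← Real.sqrt_sq (norm_nonneg (fun j => (a j : ℝ))),
    ← Real.sqrt_mul (Nat.cast_nonneg k)]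
  refine Real.sqrt_le_sqrt ?_
  calc ∑ j, (a j : ℝ) ^ 2 ≤ ∑ _j : Fin k, ‖fun j => (a j : ℝ)‖ ^ 2 := by
        refine Finset.sum_le_sum fun j _ => ?_
        rw [← sq_abs]
        have := norm_le_pi_norm (fun j => (a j : ℝ)) j
        rw [Real.norm_eq_abs] at this
        gcongr
    _ = _ := by simp

/-- A linear map on `ℝ^k` that is proper on the integer lattice is injective. -/
lemma LinearMap.injective_of_finite_lattice {k : ℕ} {E : Type*} [NormedAddCommGroup E]
    [NormedSpace ℝ E] (L : (Fin k → ℝ) →ₗ[ℝ] E)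
    (hL : ∀ c : ℝ, {a : Fin k → ℤ | ‖L fun j => (a j : ℝ)‖ ≤ c}.Finite) :
    Function.Injective L := by
  rw [← LinearMap.ker_eq_bot, LinearMap.ker_eq_bot']
  intro t ht
  by_contra hne
  obtain ⟨j, hj⟩ := Function.ne_iff.mp hne
  rw [Pi.zero_apply] at hj
  set s : Fin k → ℝ := (t j)⁻¹ • t with hs
  have hLs : L s = 0 := by rw [hs, map_smul, ht, smul_zero]
  have hsj : s j = 1 := by simp [hs, hj]
  set L' := LinearMap.toContinuousLinearMap L with hL'
  set a : ℕ → Fin k → ℤ := fun N i => ⌊(N : ℝ) * s i⌋ with ha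
  have hinj : Function.Injective a := by
    intro N M h
    have := congrFun h j
    simpa [ha, hsj] using this
  refine Set.infinite_range_of_injective hinj ((hL ‖L'‖).subset ?_)
  rintro _ ⟨N, rfl⟩
  rw [Set.mem_ofPred_eq]
  have h1 : L (fun i => (a N i : ℝ)) = L' ((fun i => (a N i : ℝ)) - (N : ℝ) • s) := by
    rw [map_sub, map_smul]
    change _ = L _ - (N : ℝ) • L s
    rw [hLs, smul_zero, sub_zero]
  rw [h1]
  refine (L'.le_opNorm _).trans (mul_le_of_le_one_right (norm_nonneg _) ?_)
  rw [pi_norm_le_iff_of_nonneg zero_le_one]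
  intro i
  simp only [ha, Pi.sub_apply, Pi.smul_apply, smul_eq_mul, Real.norm_eq_abs]
  rw [abs_sub_comm, abs_of_nonneg (sub_nonneg.mpr (Int.floor_le _))]
  linarith [Int.lt_floor_add_one ((N : ℝ) * s i)]

/-- An additive map from `ℤ^k` that is proper grows at least linearly. -/
lemma exists_linear_growth {k : ℕ} {E : Type*} [NormedAddCommGroup E]
    [NormedSpace ℝ E] (ℓ : (Fin k → ℤ) →+ E)
    (hℓ : ∀ c : ℝ, {a : Fin k → ℤ | ‖ℓ a‖ ≤ c}.Finite) :
    ∃ c > 0, ∀ a, c * latticeNorm a ≤ ‖ℓ a‖ := by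
  set L : (Fin k → ℝ) →ₗ[ℝ] E := Fintype.linearCombination ℝ (fun j => ℓ (Pi.single j 1)) with hLdef
  have hLℓ : ∀ a : Fin k → ℤ, L (fun j => (a j : ℝ)) = ℓ a := by
    intro a
    conv_rhs => rw [← Finset.univ_sum_single a, map_sum]
    rw [hLdef, Fintype.linearCombination_apply]
    refine Finset.sum_congr rfl fun j _ => ?_
    rw [Int.cast_smul_eq_zsmul, ← map_zsmul, ← Pi.single_smul, smul_eq_mul, mul_one]
  have hinj : Function.Injective L :=
    L.injective_of_finite_lattice fun c => by simpa only [hLℓ] using hℓ c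
  obtain ⟨K, hK, hanti⟩ := L.injective_iff_antilipschitz.mp hinj
  refine ⟨(K * (Real.sqrt k + 1))⁻¹, by positivity, fun a => ?_⟩
  have h := hanti.le_mul_norm (map_zero L) (fun j => (a j : ℝ))
  rw [hLℓ] at h
  rw [inv_mul_le_iff₀ (by positivity)]
  refine (latticeNorm_le a).trans ?_
  have := Real.sqrt_nonneg (k : ℝ)
  have hK' : (0:ℝ) < K := hK
  calc Real.sqrt k * ‖fun j => (a j : ℝ)‖ ≤ (Real.sqrt k + 1) * (K * ‖ℓ a‖) := by gcongr; linarith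
    _ = _ := by ring

lemma NumberField.of_isFractionRing (D K : Type*) [CommRing D] [IsDomain D] [CharZero D]
    [Module.Finite ℤ D] [Field K] [Algebra D K] [IsFractionRing D K] : NumberField K := by
  have : CharZero K := charZero_of_injective_algebraMap (IsFractionRing.injective D K)
  refine { to_charZero := this, to_finiteDimensional := ?_ }
  obtain ⟨_, s, hs⟩ := Module.Finite.exists_fin (R := ℤ) (M := D)
  exact Module.finite_def.mpr <|
    (span_eq_top_localization_localization ℚ (nonZeroDivisors ℤ) K hs) ▸
      Submodule.fg_span (Set.toFinite _)

lemma NumberField.one_le_prod_norm_embeddings {K : Type*} [Field K] [NumberField K] {x : K}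
    (hx : IsIntegral ℤ x) (h0 : x ≠ 0) : 1 ≤ ∏ σ : K →+* ℂ, ‖σ x‖ := by
  have h1 : ‖algebraMap ℚ ℂ (Algebra.norm ℚ x)‖ = ∏ σ : K →+* ℂ, ‖σ x‖ := by
    rw [Algebra.norm_eq_prod_embeddings, norm_prod]
    exact Fintype.prod_equiv (RingHom.equivRatAlgHom K ℂ).symm _ _ (fun σ => by rfl)
  rw [← h1]
  obtain ⟨z, hz⟩ := IsIntegrallyClosed.isIntegral_iff.mp (Algebra.isIntegral_norm ℚ hx)
  have hz0 : z ≠ 0 := by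
    rintro rfl
    rw [map_zero] at hz
    exact h0 (Algebra.norm_eq_zero_iff.mp hz.symm)
  rw [← hz]
  simp only [eq_intCast, map_intCast, Complex.norm_intCast]
  exact_mod_cast Int.one_le_abs hz0

open Classical in
/-- For a nonzero algebraic integer all of whose conjugates are at most `T` in absolute value, no
conjugate is smaller than `T ^ (1 - d)`. -/
lemma NumberField.one_le_norm_embedding_mul_pow {K : Type*} [Field K] [NumberField K] {x : K}
    (hx : IsIntegral ℤ x) (h0 : x ≠ 0) {T : ℝ} (hT : ∀ σ : K →+* ℂ, ‖σ x‖ ≤ T) (σ : K →+* ℂ) :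
    1 ≤ ‖σ x‖ * T ^ (Fintype.card (K →+* ℂ) - 1) := by
  refine (one_le_prod_norm_embeddings hx h0).trans ?_
  rw [← Finset.mul_prod_erase _ _ (Finset.mem_univ σ)]
  gcongr
  refine (Finset.prod_le_prod (fun _ _ => norm_nonneg _) fun τ _ => hT τ).trans ?_
  rw [Finset.prod_const, Finset.card_erase_of_mem (Finset.mem_univ σ), Finset.card_univ]

/-- Every non-torsion vector `m` of the module is made exponentially long, either by itself or after
applying `u a`, when length is measured by finitely many additive functionals. -/
def ExpandsNontorsion {k : ℕ} {R : Type*} [CommRing R] (u : (Fin k → ℤ) → R)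
    (N : Type*) [AddCommGroup N] [Module R N] : Prop :=
  ∃ ρ > (1 : ℝ), ∃ S : Finset (N →+ ℂ), ∀ (a : Fin k → ℤ) (m : N),
    (∀ z : ℤ, z ≠ 0 → z • m ≠ 0) →
      ∃ φ ∈ S, ρ ^ latticeNorm a ≤ ‖φ m‖ ∨ ρ ^ latticeNorm a ≤ ‖φ (u a • m)‖

open Classical in
/-- In an order of a number field, a free abelian group of units expands. -/
lemma expandsNontorsion_self {k : ℕ} {D : Type*} [CommRing D] [IsDomain D] [CharZero D]
    [Module.Finite ℤ D] (u : (Fin k → ℤ) → D) (hu0 : u 0 = 1)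
    (huadd : ∀ a b, u (a + b) = u a * u b) (hu : ∀ a, a ≠ 0 → u a ≠ 1) :
    ExpandsNontorsion u D := by
  obtain ⟨K, _, _, _⟩ : ∃ (K : Type _) (_ : Field K) (_ : Algebra D K), IsFractionRing D K :=
    ⟨FractionRing D, inferInstance, inferInstance, inferInstance⟩
  have : NumberField K := NumberField.of_isFractionRing D K
  set d := Fintype.card (K →+* ℂ) with hd
  have hdpos : 0 < d := Fintype.card_pos
  have hint : ∀ x : D, IsIntegral ℤ (algebraMap D K x) := fun x =>
    (Algebra.IsIntegral.isIntegral (R := ℤ) x).map (IsScalarTower.toAlgHom ℤ D K)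
  have hK0 : ∀ x : D, x ≠ 0 → algebraMap D K x ≠ 0 := fun x hx =>
    (map_ne_zero_iff _ (IsFractionRing.injective D K)).mpr hx
  have hune : ∀ a, u a ≠ 0 := fun a h => by
    have := huadd a (-a)
    rw [add_neg_cancel, hu0, h, zero_mul] at this
    exact one_ne_zero this
  have hpos : ∀ x : D, x ≠ 0 → ∀ σ : K →+* ℂ, 0 < ‖σ (algebraMap D K x)‖ := fun x hx σ =>
    norm_pos_iff.mpr ((map_ne_zero σ).mpr (hK0 x hx))
  have huinj : Function.Injective u := fun a b h => by
    by_contra hab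
    refine hu (a - b) (sub_ne_zero.mpr hab) (mul_right_cancel₀ (hune b) ?_)
    rw [← huadd, sub_add_cancel, h, one_mul]
  let ℓ : (Fin k → ℤ) →+ ((K →+* ℂ) → ℝ) :=
    { toFun := fun a σ => Real.log ‖σ (algebraMap D K (u a))‖
      map_zero' := by ext; simp [hu0]
      map_add' := fun a b => by
        ext σ
        simp only [huadd, map_mul, norm_mul, Pi.add_apply]
        exact Real.log_mul (hpos _ (hune a) σ).ne' (hpos _ (hune b) σ).ne' }
  have hℓ : ∀ c : ℝ, {a : Fin k → ℤ | ‖ℓ a‖ ≤ c}.Finite := by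
    intro c
    refine Set.Finite.of_finite_image (f := fun a => algebraMap D K (u a))
      ((NumberField.Embeddings.finite_of_norm_le K ℂ (Real.exp c)).subset ?_)
      (((IsFractionRing.injective D K).comp huinj).injOn)
    rintro _ ⟨a, ha, rfl⟩
    refine ⟨hint _, fun σ => ?_⟩
    rw [← Real.log_le_iff_le_exp (hpos _ (hune a) σ)]
    exact (le_abs_self _).trans ((norm_le_pi_norm (ℓ a) σ).trans ha)
  obtain ⟨c, hc, hgrow⟩ := exists_linear_growth ℓ hℓ
  refine ⟨Real.exp (c / d), Real.one_lt_exp_iff.mpr (by positivity),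
    Finset.univ.image fun σ : K →+* ℂ => (σ.comp (algebraMap D K)).toAddMonoidHom,
    fun a m hm => ?_⟩
  have hm0 : m ≠ 0 := fun h => hm 1 one_ne_zero (by simp [h])
  by_contra! hcon
  set T := Real.exp (c / d) ^ latticeNorm a with hT
  have hTpos : 0 < T := by positivity
  have hTd : T ^ d = Real.exp (c * latticeNorm a) := by
    rw [hT, ← Real.exp_mul, ← Real.exp_nat_mul]
    congr 1
    field_simp
  have hb : ∀ σ : K →+* ℂ,
      ‖σ (algebraMap D K m)‖ < T ∧ ‖σ (algebraMap D K (u a * m))‖ < T := fun σ => by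
    simpa using hcon _ (Finset.mem_image_of_mem _ (Finset.mem_univ σ))
  have hpow : T * T ^ (d - 1) = T ^ d := mul_pow_sub_one hdpos.ne' T
  refine absurd (hgrow a) (not_le.mpr ?_)
  obtain ⟨σ, -, hmax⟩ :=
    Finset.exists_max_image Finset.univ (fun σ => ‖ℓ a σ‖) Finset.univ_nonempty
  refine ((pi_norm_le_iff_of_nonneg (norm_nonneg _)).mpr
    fun τ => hmax τ (Finset.mem_univ τ)).trans_lt ?_
  have h1 := NumberField.one_le_norm_embedding_mul_pow (hint m) (hK0 m hm0)
    (fun σ => (hb σ).1.le) σ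
  have h2 := NumberField.one_le_norm_embedding_mul_pow (hint (u a * m))
    (hK0 _ (mul_ne_zero (hune a) hm0)) (fun σ => (hb σ).2.le) σ
  have hσ := hpos _ (hune a) σ
  have hT1 : 0 < T ^ (d - 1) := by positivity
  have hmul : ‖σ (algebraMap D K (u a * m))‖ =
      ‖σ (algebraMap D K (u a))‖ * ‖σ (algebraMap D K m)‖ := by simp
  change |Real.log ‖σ (algebraMap D K (u a))‖| < _
  rw [abs_lt, neg_lt, ← Real.log_inv, ← Real.log_exp (c * latticeNorm a), ← hTd]
  constructor
  · refine Real.log_lt_log (by positivity) ?_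
    rw [inv_lt_iff_one_lt_mul₀ hσ]
    calc 1 ≤ _ := h2
      _ = (‖σ (algebraMap D K m)‖ * T ^ (d - 1)) * ‖σ (algebraMap D K (u a))‖ := by
        rw [hmul]; ring
      _ < (T * T ^ (d - 1)) * ‖σ (algebraMap D K (u a))‖ := by
        have := (hb σ).1
        gcongr
      _ = _ := by rw [hpow]
  · refine Real.log_lt_log hσ ?_
    calc ‖σ (algebraMap D K (u a))‖ = ‖σ (algebraMap D K (u a))‖ * 1 := (mul_one _).symm
      _ ≤ ‖σ (algebraMap D K (u a))‖ * (‖σ (algebraMap D K m)‖ * T ^ (d - 1)) := by gcongr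
      _ = ‖σ (algebraMap D K (u a * m))‖ * T ^ (d - 1) := by rw [hmul]; ring
      _ < T * T ^ (d - 1) := by
        have := (hb σ).2
        gcongr
      _ = _ := hpow

lemma latticeNorm_nonneg {k : ℕ} (a : Fin k → ℤ) : 0 ≤ latticeNorm a := Real.sqrt_nonneg _

/-- Expansion passes to a module that embeds semilinearly in an expanding one. -/
lemma ExpandsNontorsion.of_injective {k : ℕ} {R D N M : Type*} [CommRing R] [CommRing D]
    [AddCommGroup N] [Module R N] [AddCommGroup M] [Module D M] {u : (Fin k → ℤ) → R}
    {w : (Fin k → ℤ) → D} (e : N →+ M) (he : Function.Injective e)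
    (hew : ∀ a m, e (u a • m) = w a • e m) (h : ExpandsNontorsion w M) :
    ExpandsNontorsion u N := by
  classical
  obtain ⟨ρ, hρ, S, hS⟩ := h
  refine ⟨ρ, hρ, S.image fun φ => φ.comp e, fun a m hm => ?_⟩
  obtain ⟨φ, hφ, h⟩ := hS a (e m) fun z hz h0 => hm z hz (he (by rw [map_zsmul, h0, map_zero]))
  refine ⟨_, Finset.mem_image_of_mem _ hφ, ?_⟩
  simpa only [AddMonoidHom.comp_apply, hew] using h

lemma exists_torsion_exponent (N : Type*) [AddCommGroup N] [Module.Finite ℤ N] :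
    ∃ e : ℤ, e ≠ 0 ∧ ∀ m : N, (∃ z : ℤ, z ≠ 0 ∧ z • m = 0) → e • m = 0 := by
  obtain ⟨e, he, he0⟩ := Submodule.annihilator_top_inter_nonZeroDivisors
    (Submodule.torsion_isTorsion (R := ℤ) (M := N))
  refine ⟨e, nonZeroDivisors.ne_zero he0, fun m ⟨z, hz, hzm⟩ => ?_⟩
  have hm : m ∈ Submodule.torsion ℤ N :=
    ⟨⟨z, mem_nonZeroDivisors_of_ne_zero hz⟩, hzm⟩
  have := Submodule.mem_annihilator.mp he ⟨m, hm⟩ trivial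
  simpa using congrArg Subtype.val this

/-- Expansion is inherited by extensions. -/
lemma ExpandsNontorsion.of_exact {k : ℕ} {R N₁ N₂ N₃ : Type*} [CommRing R]
    [AddCommGroup N₁] [Module R N₁] [AddCommGroup N₂] [Module R N₂] [AddCommGroup N₃] [Module R N₃]
    [Module.Finite ℤ N₃] {u : (Fin k → ℤ) → R} (f : N₁ →ₗ[R] N₂) (g : N₂ →ₗ[R] N₃)
    (hf : Function.Injective f) (hfg : Function.Exact f g)
    (h₁ : ExpandsNontorsion u N₁) (h₃ : ExpandsNontorsion u N₃) : ExpandsNontorsion u N₂ := by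
  classical
  obtain ⟨ρ₁, hρ₁, S₁, hS₁⟩ := h₁
  obtain ⟨ρ₃, hρ₃, S₃, hS₃⟩ := h₃
  obtain ⟨e, he0, he⟩ := exists_torsion_exponent N₃
  have hext : ∀ φ : N₁ →+ ℂ, ∃ ψ : N₂ →+ ℂ, ψ.comp f.toAddMonoidHom = φ := fun φ =>
    (Module.Baer.of_divisible ℂ).extension_property_addMonoidHom f.toAddMonoidHom hf φ
  choose E hE using hext
  have hE' : ∀ φ x, E φ (f x) = φ x := fun φ x => DFunLike.congr_fun (hE φ) x
  have hmin : 1 < min ρ₁ ρ₃ := lt_min hρ₁ hρ₃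
  refine ⟨min ρ₁ ρ₃, hmin,
    (S₁.image fun φ => e • E φ) ∪ S₃.image fun φ => φ.comp g.toAddMonoidHom, fun a m hm => ?_⟩
  by_cases hgm : ∃ z : ℤ, z ≠ 0 ∧ z • g m = 0
  · have h0 : g (e • m) = 0 := by rw [map_zsmul, he _ hgm]
    obtain ⟨m₁, hm₁⟩ := (hfg _).mp h0
    obtain ⟨φ, hφ, h⟩ := hS₁ a m₁ fun z hz h0 => hm (z * e) (mul_ne_zero hz he0) (by
      rw [mul_smul, ← hm₁, ← map_zsmul, h0, map_zero])
    refine ⟨_, Finset.mem_union_left _ (Finset.mem_image_of_mem _ hφ), ?_⟩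
    have hle : min ρ₁ ρ₃ ^ latticeNorm a ≤ ρ₁ ^ latticeNorm a :=
      Real.rpow_le_rpow (by linarith) (min_le_left _ _) (latticeNorm_nonneg a)
    have e1 : (e • E φ) m = φ m₁ := by
      rw [AddMonoidHom.smul_apply, ← map_zsmul, ← hm₁, hE']
    have e2 : (e • E φ) (u a • m) = φ (u a • m₁) := by
      rw [AddMonoidHom.smul_apply, ← map_zsmul, smul_comm, ← hm₁, ← map_smul, hE']
    rw [e1, e2]
    exact h.imp hle.trans hle.trans
  · push Not at hgm
    obtain ⟨φ, hφ, h⟩ := hS₃ a (g m) hgm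
    refine ⟨_, Finset.mem_union_right _ (Finset.mem_image_of_mem _ hφ), ?_⟩
    have hle : min ρ₁ ρ₃ ^ latticeNorm a ≤ ρ₃ ^ latticeNorm a :=
      Real.rpow_le_rpow (by linarith) (min_le_right _ _) (latticeNorm_nonneg a)
    rw [← map_smul] at h
    exact h.imp hle.trans hle.trans

lemma ExpandsNontorsion.of_forall_torsion {k : ℕ} {R N : Type*} [CommRing R]
    [AddCommGroup N] [Module R N] (u : (Fin k → ℤ) → R)
    (h : ∀ m : N, ∃ z : ℤ, z ≠ 0 ∧ z • m = 0) : ExpandsNontorsion u N :=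
  ⟨2, one_lt_two, ∅, fun _ m hm => by
    obtain ⟨z, hz, hzm⟩ := h m
    exact absurd hzm (hm z hz)⟩

/-- A free abelian group of units in a commutative ring finite over `ℤ`, none of which has `1` as a
complex eigenvalue, expands every finitely generated module. -/
theorem expandsNontorsion_of_finite {k : ℕ} {R M : Type*} [CommRing R] [Module.Finite ℤ R]
    [AddCommGroup M] [Module R M] [hM : Module.Finite R M] (u : (Fin k → ℤ) → R) (hu0 : u 0 = 1)
    (huadd : ∀ a b, u (a + b) = u a * u b)
    (hu : ∀ (σ : R →+* ℂ) (a : Fin k → ℤ), a ≠ 0 → σ (u a) ≠ 1) : ExpandsNontorsion u M := by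
  have : IsNoetherianRing R := isNoetherian_of_tower ℤ inferInstance
  induction hM using IsNoetherianRing.induction_on_isQuotientEquivQuotientPrime R with
  | subsingleton N => exact .of_forall_torsion u fun m => ⟨1, one_ne_zero, Subsingleton.elim _ _⟩
  | exact N₁ N₂ N₃ f g hf hg hfg h₁ h₃ =>
    have : Module.Finite ℤ N₃ := Module.Finite.trans R N₃
    exact .of_exact f g hf hfg h₁ h₃
  | quotient N p e =>
    by_cases hinj : Function.Injective (Int.castAddHom (R ⧸ p.1))
    · have : CharZero (R ⧸ p.1) := ⟨fun a b h => by
        have : ((a : ℤ) : R ⧸ p.1) = ((b : ℤ) : R ⧸ p.1) := by simpa using h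
        exact_mod_cast hinj this⟩
      let σ : R ⧸ p.1 →ₐ[ℤ] ℂ := IsAlgClosed.lift
      refine .of_injective (w := fun a => Ideal.Quotient.mk p.1 (u a)) (M := R ⧸ p.1)
        e.toLinearMap.toAddMonoidHom e.injective (fun a m => e.map_smul (u a) m) ?_
      refine expandsNontorsion_self _ (by simp [hu0]) (fun a b => by simp [huadd]) ?_
      intro a ha h
      refine hu (σ.toRingHom.comp (Ideal.Quotient.mk p.1)) a ha ?_
      simp [h]
    · rw [injective_iff_map_eq_zero] at hinj
      push Not at hinj
      obtain ⟨z, hz, hz0⟩ := hinj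
      refine .of_forall_torsion u fun m => ⟨z, hz0, e.injective ?_⟩
      have hz : (z : R ⧸ p.1) = 0 := hz
      rw [map_zsmul, map_zero, zsmul_eq_mul, hz, zero_mul]

lemma AddMonoidHom.norm_le_sum_mul_norm {ι : Type*} [Fintype ι] [DecidableEq ι]
    {E : Type*} [NormedAddCommGroup E] [NormedSpace ℝ E] (φ : (ι → ℤ) →+ E) (m : ι → ℤ) :
    ‖φ m‖ ≤ (∑ i, ‖φ (Pi.single i 1)‖) * ‖m‖ := by
  conv_lhs => rw [← Finset.univ_sum_single m, map_sum]
  rw [Finset.sum_mul]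
  refine (norm_sum_le _ _).trans (Finset.sum_le_sum fun i _ => ?_)
  have : Pi.single i (m i) = m i • (Pi.single i 1 : ι → ℤ) := by
    rw [← Pi.single_smul, smul_eq_mul, mul_one]
  rw [this, map_zsmul, ← Int.cast_smul_eq_zsmul ℝ, norm_smul, mul_comm, Int.norm_cast_real]
  gcongr
  exact norm_le_pi_norm m i

open scoped IsMulCommutative in
/-- An ergodic `ℤ^k`-action by integer matrices expands nonzero integer row vectors exponentially:
`m` and its image cannot both be short. -/
theorem exists_exponential_expansion {k n : ℕ} (B : (Fin k → ℤ) → Matrix (Fin n) (Fin n) ℤ)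
    (hB0 : B 0 = 1) (hBadd : ∀ a b, B (a + b) = B a * B b)
    (hB1 : ∀ a : Fin k → ℤ, a ≠ 0 → ¬ (((B a).map (Int.cast : ℤ → ℂ)).charpoly).IsRoot 1) :
    ∃ ρ > (1 : ℝ), ∃ c > (0 : ℝ), ∀ (a : Fin k → ℤ) (m : Fin n → ℤ), m ≠ 0 →
      c * ρ ^ latticeNorm a ≤ ‖m‖ ∨ c * ρ ^ latticeNorm a ≤ ‖Matrix.vecMul m (B a)‖ := by
  set E : (Fin k → ℤ) → Module.End ℤ (Fin n → ℤ) :=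
    fun a => Matrix.toLinAlgEquiv' (B a).transpose with hE
  have hE0 : E 0 = 1 := by simp [hE, hB0]
  have hEadd : ∀ a b, E (a + b) = E a * E b := fun a b => by
    rw [add_comm, hE]
    simp only [hBadd, Matrix.transpose_mul, map_mul]
  have hcomm : ∀ x ∈ Set.range E, ∀ y ∈ Set.range E, x * y = y * x := by
    rintro _ ⟨a, rfl⟩ _ ⟨b, rfl⟩
    rw [← hEadd, add_comm, hEadd]
  have := Algebra.isMulCommutative_adjoin ℤ hcomm
  set R := Algebra.adjoin ℤ (Set.range E) with hR
  let u : (Fin k → ℤ) → R := fun a => ⟨E a, Algebra.subset_adjoin ⟨a, rfl⟩⟩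
  have hfin : Module.Finite ℤ R :=
    Module.Finite.of_injective R.val.toLinearMap Subtype.val_injective
  have hM : Module.Finite R (Fin n → ℤ) := Module.Finite.of_restrictScalars_finite ℤ R _
  have hexp : ExpandsNontorsion u (Fin n → ℤ) := by
    refine expandsNontorsion_of_finite u (Subtype.ext hE0)
      (fun a b => Subtype.ext (hEadd a b)) fun σ a ha h => hB1 a ha ?_
    have h0 : Polynomial.aeval (E a) (B a).charpoly = 0 := by
      rw [hE, Polynomial.aeval_algHom_apply, ← Matrix.charpoly_transpose,
        Matrix.aeval_self_charpoly, map_zero]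
    have h1 : Polynomial.aeval (u a) (B a).charpoly = 0 := by
      apply Subtype.ext
      have := Polynomial.aeval_algHom_apply R.val (u a) (B a).charpoly
      exact this.symm.trans h0
    have h2 := Polynomial.hom_eval₂ (B a).charpoly (algebraMap ℤ R) σ (u a)
    rw [← Polynomial.aeval_def, h1, map_zero, h] at h2
    have h3 : ((B a).map (Int.cast : ℤ → ℂ)).charpoly =
        (B a).charpoly.map (Int.castRingHom ℂ) := Matrix.charpoly_map (B a) (Int.castRingHom ℂ)
    rw [h3, Polynomial.IsRoot.def, Polynomial.eval_map, h2]
    congr 1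
    exact RingHom.ext_int _ _
  obtain ⟨ρ, hρ, S, hS⟩ := hexp
  set C : ℝ := 1 + ∑ φ ∈ S, ∑ i, ‖φ (Pi.single i 1)‖ with hC
  have hCpos : 0 < C := by positivity
  have hφ : ∀ φ ∈ S, ∀ m, ‖φ m‖ ≤ C * ‖m‖ := fun φ hφ m => by
    refine (φ.norm_le_sum_mul_norm m).trans ?_
    gcongr
    have := Finset.single_le_sum (f := fun φ : (Fin n → ℤ) →+ ℂ => ∑ i, ‖φ (Pi.single i 1)‖)
      (fun _ _ => by positivity) hφ
    linarith
  refine ⟨ρ, hρ, C⁻¹, by positivity, fun a m hm => ?_⟩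
  obtain ⟨φ, hφS, h⟩ := hS a m fun z hz => smul_ne_zero hz hm
  have hact : u a • m = Matrix.vecMul m (B a) := by
    change Matrix.toLinAlgEquiv' (B a).transpose m = _
    rw [Matrix.toLinAlgEquiv'_apply, Matrix.mulVec_transpose]
  rw [hact] at h
  simp only [inv_mul_le_iff₀ hCpos]
  exact h.imp (fun h => h.trans (hφ φ hφS _)) fun h => h.trans (hφ φ hφS _)

noncomputable section Torus

open UnitAddTorus

local instance : MeasureSpace UnitAddCircle := ⟨AddCircle.haarAddCircle⟩

local instance : Measure.IsAddHaarMeasure (volume : Measure UnitAddCircle) :=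
  inferInstanceAs (Measure.IsAddHaarMeasure AddCircle.haarAddCircle)

local instance : IsProbabilityMeasure (volume : Measure UnitAddCircle) :=
  inferInstanceAs (IsProbabilityMeasure AddCircle.haarAddCircle)

/-- A continuous `ℤ^n`-periodic function descends to the torus. -/
lemma exists_continuousMap_torus {ι : Type*} {f : (ι → ℝ) → ℝ} (hf : Continuous f)
    (hper : ∀ (x : ι → ℝ) (z : ι → ℤ), f (x + fun i => (z i : ℝ)) = f x) :
    ∃ F : C(UnitAddTorus ι, ℝ), ∀ x : ι → ℝ, F (fun i => (x i : UnitAddCircle)) = f x := by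
  have hq : IsOpenQuotientMap
      (Pi.map fun (_ : ι) (x : ℝ) => (x : UnitAddCircle) : (ι → ℝ) → UnitAddTorus ι) :=
    IsOpenQuotientMap.piMap fun _ => QuotientAddGroup.isOpenQuotientMap_mk
  let q : C(ι → ℝ, UnitAddTorus ι) := ⟨_, hq.continuous⟩
  have hfac : Function.FactorsThrough (⟨f, hf⟩ : C(ι → ℝ, ℝ)) q := by
    intro x y hxy
    have hz : ∀ i, ∃ z : ℤ, y i + z = x i := by
      intro i
      have hi : ((x i - y i : ℝ) : UnitAddCircle) = 0 := by
        rw [AddCircle.coe_sub, sub_eq_zero]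
        exact congrFun hxy i
      obtain ⟨z, hz⟩ := AddCircle.coe_eq_zero_iff 1 |>.1 hi
      exact ⟨z, by simp at hz; linarith⟩
    choose z hz using hz
    have : x = y + fun i => (z i : ℝ) := funext fun i => (hz i).symm
    rw [this]
    exact hper y z
  refine ⟨hq.isQuotientMap.lift (f := q) ⟨f, hf⟩ hfac, fun x => ?_⟩
  exact DFunLike.congr_fun (hq.isQuotientMap.lift_comp (f := q) ⟨f, hf⟩ hfac) x

variable {ι : Type*} [Fintype ι]

lemma mFourier_eq_toCircle (l : ι → ℤ) (t : UnitAddTorus ι) :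
    mFourier l t = AddCircle.toCircle (∑ i, l i • t i) := by
  have hadd : ∀ s : Finset ι, ∀ x : ι → UnitAddCircle,
      AddCircle.toCircle (∑ i ∈ s, x i) = ∏ i ∈ s, AddCircle.toCircle (x i) := by
    classical
    intro s x
    induction s using Finset.induction_on with
    | empty => simp
    | insert i s hi ih => rw [Finset.sum_insert hi, Finset.prod_insert hi,
        AddCircle.toCircle_add, ih]
  rw [hadd]
  refine Eq.trans ?_ (map_prod Circle.coeHom _ _).symm
  simp only [mFourier, ContinuousMap.coe_mk, fourier_apply]
  rfl

lemma mFourier_add_apply (l : ι → ℤ) (s t : UnitAddTorus ι) :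
    mFourier l (s + t) = mFourier l s * mFourier l t := by
  simp only [mFourier_eq_toCircle, Pi.add_apply, smul_add, Finset.sum_add_distrib,
    AddCircle.toCircle_add, Circle.coe_mul]

lemma norm_mFourier_apply (l : ι → ℤ) (t : UnitAddTorus ι) : ‖mFourier l t‖ = 1 := by
  rw [mFourier_eq_toCircle, Circle.norm_coe]

/-- The endomorphism of the torus induced by an integer matrix. -/
def torusEndo (M : Matrix ι ι ℤ) : UnitAddTorus ι →+ UnitAddTorus ι where
  toFun t i := ∑ j, M i j • t j
  map_zero' := by ext; simp
  map_add' s t := by ext; simp [Finset.sum_add_distrib]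

lemma torusEndo_apply (M : Matrix ι ι ℤ) (t : UnitAddTorus ι) (i : ι) :
    torusEndo M t i = ∑ j, M i j • t j := rfl

lemma continuous_torusEndo (M : Matrix ι ι ℤ) : Continuous (torusEndo M) := by
  refine continuous_pi fun i => ?_
  simp only [torusEndo_apply]
  fun_prop

lemma torusEndo_mul (M M' : Matrix ι ι ℤ) (t : UnitAddTorus ι) :
    torusEndo (M * M') t = torusEndo M (torusEndo M' t) := by
  ext i
  simp only [torusEndo_apply, Matrix.mul_apply, Finset.sum_smul, Finset.smul_sum, mul_smul]
  exact Finset.sum_comm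

lemma torusEndo_one [DecidableEq ι] (t : UnitAddTorus ι) : torusEndo (1 : Matrix ι ι ℤ) t = t := by
  ext i
  simp [torusEndo_apply, Matrix.one_apply]

lemma mFourier_torusEndo (l : ι → ℤ) (M : Matrix ι ι ℤ) (t : UnitAddTorus ι) :
    mFourier l (torusEndo M t) = mFourier (Matrix.vecMul l M) t := by
  rw [mFourier_eq_toCircle, mFourier_eq_toCircle]
  congr 2
  simp only [torusEndo_apply, Matrix.vecMul, dotProduct, Finset.sum_smul, Finset.smul_sum, mul_smul]
  exact Finset.sum_comm

lemma measurePreserving_torusEndo [DecidableEq ι] {M M' : Matrix ι ι ℤ} (h : M * M' = 1) :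
    MeasurePreserving (torusEndo M) := by
  refine AddMonoidHom.measurePreserving (continuous_torusEndo M) (fun t => ⟨torusEndo M' t, ?_⟩) rfl
  rw [← torusEndo_mul, h, torusEndo_one]

/-- The affine self-map of the torus with linear part `M` and translation part `v`. -/
def torusAffine (M : Matrix ι ι ℤ) (v : UnitAddTorus ι) : C(UnitAddTorus ι, UnitAddTorus ι) :=
  ⟨fun t => torusEndo M t + v, (continuous_torusEndo M).add continuous_const⟩

lemma measurePreserving_torusAffine [DecidableEq ι] {M M' : Matrix ι ι ℤ} (h : M * M' = 1)
    (v : UnitAddTorus ι) : MeasurePreserving (torusAffine M v) :=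
  (measurePreserving_add_right volume v).comp (measurePreserving_torusEndo h)

lemma integral_comp_torusAffine [DecidableEq ι] {M M' : Matrix ι ι ℤ} (h : M * M' = 1)
    (v : UnitAddTorus ι) {E : Type*} [NormedAddCommGroup E] [NormedSpace ℝ E]
    (F : C(UnitAddTorus ι, E)) : ∫ t, F (torusAffine M v t) = ∫ t, F t := by
  have hmp := measurePreserving_torusAffine h v
  conv_rhs => rw [← hmp.map_eq]
  exact (integral_map hmp.measurable.aemeasurable F.continuous.aestronglyMeasurable).symm

lemma norm_mFourierCoeff_comp_torusAffine [DecidableEq ι] {M M' : Matrix ι ι ℤ} (h : M * M' = 1)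
    (v : UnitAddTorus ι) (F : C(UnitAddTorus ι, ℂ)) (l : ι → ℤ) :
    ‖mFourierCoeff (F.comp (torusAffine M v)) (Matrix.vecMul l M)‖ = ‖mFourierCoeff F l‖ := by
  have key : mFourierCoeff (F.comp (torusAffine M v)) (Matrix.vecMul l M) =
      mFourier l v * mFourierCoeff F l := by
    rw [mFourierCoeff, mFourierCoeff, ← integral_const_mul]
    refine Eq.trans (integral_congr_ae (.of_forall fun t => ?_)) (integral_comp_torusAffine h v
      ((ContinuousMap.const _ (mFourier l v)) * (mFourier (-l) * F)))
    have h1 : mFourier (-Matrix.vecMul l M) t = mFourier l v * mFourier (-l) (torusAffine M v t) := by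
      change _ = _ * mFourier (-l) (torusEndo M t + v)
      rw [mFourier_add_apply, mFourier_torusEndo, Matrix.neg_vecMul, mul_left_comm,
        ← mFourier_add, add_neg_cancel, mFourier_zero, ContinuousMap.one_apply, mul_one]
    simp only [smul_eq_mul, ContinuousMap.comp_apply, ContinuousMap.mul_apply,
      ContinuousMap.const_apply, h1, mul_assoc]
  rw [key, norm_mul, norm_mFourier_apply, one_mul]

lemma mFourierCoeff_comp_add_right (F : C(UnitAddTorus ι, ℂ)) (h : UnitAddTorus ι) (l : ι → ℤ) :
    mFourierCoeff (fun t => F (t + h)) l = mFourier l h * mFourierCoeff F l := by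
  rw [mFourierCoeff, mFourierCoeff, ← integral_const_mul,
    ← integral_add_right_eq_self (fun t => mFourier l h * mFourier (-l) t • F t) h]
  refine integral_congr_ae (.of_forall fun t => ?_)
  simp only [smul_eq_mul, mFourier_add_apply]
  have : mFourier l h * mFourier (-l) h = 1 := by
    rw [← mFourier_add, add_neg_cancel, mFourier_zero, ContinuousMap.one_apply]
  linear_combination (-mFourier (-l) t * F (t + h)) * this

lemma hasSum_prod_mFourierCoeff_continuous (F G : C(UnitAddTorus ι, ℂ)) :
    HasSum (fun l => (starRingEnd ℂ) (mFourierCoeff F l) * mFourierCoeff G l)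
      (∫ t, (starRingEnd ℂ) (F t) * G t) := by
  have h := hasSum_prod_mFourierCoeff (F.toLp 2 volume ℂ) (G.toLp 2 volume ℂ)
  simp only [mFourierCoeff_toLp] at h
  convert h using 1
  refine integral_congr_ae ?_
  filter_upwards [F.coeFn_toLp (p := 2) (𝕜 := ℂ) volume, G.coeFn_toLp (p := 2) (𝕜 := ℂ) volume]
    with t h1 h2
  rw [h1, h2]

lemma sum_sq_norm_mFourierCoeff_le (F : C(UnitAddTorus ι, ℂ)) (s : Finset (ι → ℤ)) :
    ∑ l ∈ s, ‖mFourierCoeff F l‖ ^ 2 ≤ ∫ t, ‖F t‖ ^ 2 := by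
  have h := hasSum_sq_mFourierCoeff (F.toLp 2 volume ℂ)
  simp only [mFourierCoeff_toLp] at h
  have h2 : ∫ t, ‖F.toLp 2 volume ℂ t‖ ^ 2 = ∫ t, ‖F t‖ ^ 2 := by
    refine integral_congr_ae ?_
    filter_upwards [F.coeFn_toLp (p := 2) (𝕜 := ℂ) volume] with t h1
    rw [h1]
  rw [← h2]
  exact sum_le_hasSum s (fun _ _ => by positivity) h

lemma sq_norm_mFourier_single_sub_one [DecidableEq ι] (l : ι → ℤ) (j : ι) (s : ℝ) :
    ‖mFourier l (Pi.single j (s : UnitAddCircle)) - 1‖ ^ 2 =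
      2 - 2 * Real.cos (2 * Real.pi * l j * s) := by
  have h1 : mFourier l (Pi.single j (s : UnitAddCircle)) =
      Complex.exp ((2 * Real.pi * l j * s : ℝ) * Complex.I) := by
    rw [mFourier_eq_toCircle, Finset.sum_eq_single j (fun i _ hi => by simp [hi]) (by simp),
      Pi.single_eq_same, ← fourier_apply, fourier_coe_apply]
    congr 1
    push_cast
    ring
  rw [h1, ← Complex.normSq_eq_norm_sq, Complex.normSq_apply]
  simp only [Complex.sub_re, Complex.sub_im, Complex.exp_ofReal_mul_I_re,
    Complex.exp_ofReal_mul_I_im, Complex.one_re, Complex.one_im]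
  linear_combination Real.sin_sq_add_cos_sq (2 * Real.pi * l j * s)

lemma sum_mul_sq_norm_mFourierCoeff_le [DecidableEq ι] (F : C(UnitAddTorus ι, ℂ)) {H θ : ℝ}
    {j : ι} {s : ℝ} (hF : ∀ t, ‖F (t + Pi.single j (s : UnitAddCircle)) - F t‖ ≤ H * |s| ^ θ)
    (S : Finset (ι → ℤ)) :
    ∑ l ∈ S, (2 - 2 * Real.cos (2 * Real.pi * l j * s)) * ‖mFourierCoeff F l‖ ^ 2 ≤
      (H * |s| ^ θ) ^ 2 := by
  set h : UnitAddTorus ι := Pi.single j (s : UnitAddCircle)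
  let F' : C(UnitAddTorus ι, ℂ) := F.comp ⟨fun t => t + h, by fun_prop⟩
  have hint : ∀ (G : C(UnitAddTorus ι, ℂ)), Integrable (fun t => G t) := fun G =>
    G.continuous.integrable_of_hasCompactSupport (HasCompactSupport.of_compactSpace _)
  have hcoef : ∀ l, mFourierCoeff (F' - F) l = (mFourier l h - 1) * mFourierCoeff F l := by
    intro l
    rw [sub_mul, one_mul, ← mFourierCoeff_comp_add_right]
    simp only [mFourierCoeff, ContinuousMap.sub_apply, smul_sub]
    exact integral_sub (hint (mFourier (-l) * F')) (hint (mFourier (-l) * F))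
  calc
    _ = ∑ l ∈ S, ‖mFourierCoeff (F' - F) l‖ ^ 2 := by
      refine Finset.sum_congr rfl fun l _ => ?_
      rw [hcoef, norm_mul, mul_pow, sq_norm_mFourier_single_sub_one]
    _ ≤ ∫ t, ‖(F' - F) t‖ ^ 2 := sum_sq_norm_mFourierCoeff_le _ S
    _ ≤ ∫ _ : UnitAddTorus ι, (H * |s| ^ θ) ^ 2 := by
      refine integral_mono_of_nonneg (.of_forall fun _ => by positivity) (integrable_const _)
        (.of_forall fun t => ?_)
      exact pow_le_pow_left₀ (norm_nonneg _) (hF t) 2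
    _ = _ := by simp

lemma inv_le_integral_two_sub_two_mul_cos {m N : ℝ} (hN : 0 < N) (hm : N ≤ |m|) :
    N⁻¹ ≤ ∫ s in (0 : ℝ)..N⁻¹, (2 - 2 * Real.cos (2 * Real.pi * m * s)) := by
  have hm0 : 0 < |m| := hN.trans_le hm
  have hω : 2 * Real.pi * m ≠ 0 := by
    have := abs_pos.1 hm0
    positivity
  have hval : ∫ s in (0 : ℝ)..N⁻¹, (2 - 2 * Real.cos (2 * Real.pi * m * s)) =
      2 * N⁻¹ - 2 * (Real.sin (2 * Real.pi * m * N⁻¹) / (2 * Real.pi * m)) := by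
    rw [intervalIntegral.integral_sub (by simp) (Continuous.intervalIntegrable (by fun_prop) _ _),
      intervalIntegral.integral_const, intervalIntegral.integral_const_mul,
      intervalIntegral.integral_comp_mul_left (fun x => Real.cos x) hω, integral_cos]
    simp
    ring
  have hbound : Real.sin (2 * Real.pi * m * N⁻¹) / (2 * Real.pi * m) ≤ N⁻¹ / 2 := by
    refine (le_abs_self _).trans ?_
    rw [abs_div, abs_mul, abs_of_pos Real.two_pi_pos, inv_eq_one_div, div_div]
    refine div_le_div₀ zero_le_one (Real.abs_sin_le_one _) (by positivity) ?_
    nlinarith [Real.pi_gt_three]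
  rw [hval]
  linarith

lemma sum_sq_norm_mFourierCoeff_le_of_coord [DecidableEq ι] (F : C(UnitAddTorus ι, ℂ)) {H θ : ℝ}
    (hθ : 0 < θ) (hH : 0 ≤ H) {j : ι}
    (hF : ∀ (s : ℝ) t, ‖F (t + Pi.single j (s : UnitAddCircle)) - F t‖ ≤ H * |s| ^ θ)
    {N : ℝ} (hN : 0 < N) (S : Finset (ι → ℤ)) (hS : ∀ l ∈ S, N ≤ |(l j : ℝ)|) :
    ∑ l ∈ S, ‖mFourierCoeff F l‖ ^ 2 ≤ (H * N ^ (-θ)) ^ 2 := by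
  have hN' : 0 < N⁻¹ := inv_pos.2 hN
  refine le_of_mul_le_mul_left ?_ hN'
  calc
    N⁻¹ * ∑ l ∈ S, ‖mFourierCoeff F l‖ ^ 2
      ≤ ∑ l ∈ S, ∫ s in (0 : ℝ)..N⁻¹,
          (2 - 2 * Real.cos (2 * Real.pi * l j * s)) * ‖mFourierCoeff F l‖ ^ 2 := by
      rw [Finset.mul_sum]
      refine Finset.sum_le_sum fun l hl => ?_
      rw [intervalIntegral.integral_mul_const]
      exact mul_le_mul_of_nonneg_right (inv_le_integral_two_sub_two_mul_cos hN (hS l hl))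
        (by positivity)
    _ = ∫ s in (0 : ℝ)..N⁻¹,
          ∑ l ∈ S, (2 - 2 * Real.cos (2 * Real.pi * l j * s)) * ‖mFourierCoeff F l‖ ^ 2 :=
      (intervalIntegral.integral_finsetSum fun l _ =>
        Continuous.intervalIntegrable (by fun_prop) _ _).symm
    _ ≤ ∫ _ in (0 : ℝ)..N⁻¹, (H * N ^ (-θ)) ^ 2 := by
      refine intervalIntegral.integral_mono_on hN'.le
        (Continuous.intervalIntegrable (by fun_prop) _ _) (by simp) fun s hs => ?_
      refine (sum_mul_sq_norm_mFourierCoeff_le F (hF s) S).trans ?_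
      rw [abs_of_nonneg hs.1, Real.rpow_neg hN.le, ← Real.inv_rpow hN.le]
      have := Real.rpow_le_rpow hs.1 hs.2 hθ.le
      have := Real.rpow_nonneg hs.1 θ
      gcongr
    _ = N⁻¹ * (H * N ^ (-θ)) ^ 2 := by simp

lemma sum_sq_norm_mFourierCoeff_le_of_norm [DecidableEq ι] (F : C(UnitAddTorus ι, ℂ)) {H θ : ℝ}
    (hθ : 0 < θ) (hH : 0 ≤ H)
    (hF : ∀ j (s : ℝ) t, ‖F (t + Pi.single j (s : UnitAddCircle)) - F t‖ ≤ H * |s| ^ θ)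
    {N : ℝ} (hN : 0 < N) (S : Finset (ι → ℤ)) (hS : ∀ l ∈ S, N ≤ ‖l‖) :
    ∑ l ∈ S, ‖mFourierCoeff F l‖ ^ 2 ≤ Fintype.card ι * (H * N ^ (-θ)) ^ 2 := by
  calc
    _ ≤ ∑ j, ∑ l ∈ S with N ≤ |(l j : ℝ)|, ‖mFourierCoeff F l‖ ^ 2 := by
      simp only [Finset.sum_filter]
      rw [Finset.sum_comm]
      refine Finset.sum_le_sum fun l hl => ?_
      obtain ⟨j, hj⟩ : ∃ j, N ≤ |(l j : ℝ)| := by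
        by_contra! hlt
        exact (hS l hl).not_gt ((pi_norm_lt_iff hN).2 fun j => by
          simpa [Int.norm_eq_abs] using hlt j)
      refine le_trans ?_ (Finset.single_le_sum (f := fun j => if N ≤ |(l j : ℝ)| then
        ‖mFourierCoeff F l‖ ^ 2 else 0) (fun i _ => by positivity) (Finset.mem_univ j))
      simp [hj]
    _ ≤ ∑ _ : ι, (H * N ^ (-θ)) ^ 2 := Finset.sum_le_sum fun j _ =>
      sum_sq_norm_mFourierCoeff_le_of_coord F hθ hH (hF j) hN _
        fun l hl => (Finset.mem_filter.1 hl).2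
    _ = _ := by simp

lemma sum_mul_le_of_sum_sq_le {α : Type*} {S : Finset α} {a b : α → ℝ} {A D : ℝ}
    (ha : ∑ l ∈ S, a l ^ 2 ≤ A) (hb : ∑ l ∈ S, b l ^ 2 ≤ D) :
    ∑ l ∈ S, a l * b l ≤ Real.sqrt A * Real.sqrt D :=
  (Real.sum_mul_le_sqrt_mul_sqrt S a b).trans (by gcongr)

/-- Quantitative decorrelation on the torus: if every nonzero frequency or its image under the
dual automorphism is at least `N`, the correlation of `θ`-Hölder functions is `O(N ^ (-θ))`. -/
lemma norm_integral_torusAffine_sub_le [DecidableEq ι] {M M' : Matrix ι ι ℤ} (h : M * M' = 1)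
    (v : UnitAddTorus ι) (F G : C(UnitAddTorus ι, ℂ)) {Hf Hg θ N : ℝ} (hθ : 0 < θ)
    (hHf : 0 ≤ Hf) (hHg : 0 ≤ Hg) (hN : 0 < N)
    (hF : ∀ j (s : ℝ) t, ‖F (t + Pi.single j (s : UnitAddCircle)) - F t‖ ≤ Hf * |s| ^ θ)
    (hG : ∀ j (s : ℝ) t, ‖G (t + Pi.single j (s : UnitAddCircle)) - G t‖ ≤ Hg * |s| ^ θ)
    (hexp : ∀ l : ι → ℤ, l ≠ 0 → N ≤ ‖l‖ ∨ N ≤ ‖Matrix.vecMul l M'‖) :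
    ‖(∫ t, (starRingEnd ℂ) (F (torusAffine M v t)) * G t) -
        (starRingEnd ℂ) (∫ t, F t) * ∫ t, G t‖ ≤
      Real.sqrt (Fintype.card ι) * N ^ (-θ) *
        (Hf * Real.sqrt (∫ t, ‖G t‖ ^ 2) + Hg * Real.sqrt (∫ t, ‖F t‖ ^ 2)) := by
  have h' : M' * M = 1 := mul_eq_one_comm.1 h
  set F' : C(UnitAddTorus ι, ℂ) := F.comp (torusAffine M v)
  have hcoef : ∀ l, ‖mFourierCoeff F' l‖ = ‖mFourierCoeff F (Matrix.vecMul l M')‖ := by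
    intro l
    rw [← norm_mFourierCoeff_comp_torusAffine h v F, Matrix.vecMul_vecMul, h', Matrix.vecMul_one]
  have hinj : Function.Injective fun l : ι → ℤ => Matrix.vecMul l M' := by
    intro l₁ l₂ h12
    simpa [Matrix.vecMul_vecMul, h'] using congrArg (fun l => Matrix.vecMul l M) h12
  have hF'F : ∫ t, ‖F' t‖ ^ 2 = ∫ t, ‖F t‖ ^ 2 :=
    integral_comp_torusAffine h v (⟨fun t => ‖F t‖ ^ 2, by fun_prop⟩ : C(UnitAddTorus ι, ℝ))
  have hsqrt : ∀ H : ℝ, 0 ≤ H → Real.sqrt (Fintype.card ι * (H * N ^ (-θ)) ^ 2) =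
      Real.sqrt (Fintype.card ι) * N ^ (-θ) * H := by
    intro H hH
    rw [Real.sqrt_mul (by positivity), Real.sqrt_sq (by positivity)]
    ring
  have hfin : ∀ S : Finset (ι → ℤ), 0 ∉ S →
      ‖∑ l ∈ S, (starRingEnd ℂ) (mFourierCoeff F' l) * mFourierCoeff G l‖ ≤
      Real.sqrt (Fintype.card ι) * N ^ (-θ) *
        (Hf * Real.sqrt (∫ t, ‖G t‖ ^ 2) + Hg * Real.sqrt (∫ t, ‖F t‖ ^ 2)) := by
    intro S hS
    refine (norm_sum_le _ _).trans ?_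
    simp only [norm_mul, RCLike.norm_conj]
    rw [← Finset.sum_filter_add_sum_filter_not S fun l => N ≤ ‖l‖]
    have hlarge := sum_mul_le_of_sum_sq_le
      ((sum_sq_norm_mFourierCoeff_le F' (S.filter fun l => N ≤ ‖l‖)).trans hF'F.le)
      (sum_sq_norm_mFourierCoeff_le_of_norm G hθ hHg hG hN (S.filter fun l => N ≤ ‖l‖)
        fun l hl => (Finset.mem_filter.1 hl).2)
    have htail : ∑ l ∈ S with ¬ N ≤ ‖l‖, ‖mFourierCoeff F' l‖ ^ 2 ≤
        Fintype.card ι * (Hf * N ^ (-θ)) ^ 2 := by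
      simp only [hcoef]
      rw [← Finset.sum_image (f := fun l => ‖mFourierCoeff F l‖ ^ 2) hinj.injOn]
      refine sum_sq_norm_mFourierCoeff_le_of_norm F hθ hHf hF hN _ fun l hl => ?_
      obtain ⟨m, hm, rfl⟩ := Finset.mem_image.1 hl
      obtain ⟨hmS, hmN⟩ := Finset.mem_filter.1 hm
      exact (hexp m fun h0 => hS (h0 ▸ hmS)).resolve_left hmN
    have hsmall := sum_mul_le_of_sum_sq_le htail
      (sum_sq_norm_mFourierCoeff_le G (S.filter fun l => ¬ N ≤ ‖l‖))
    rw [hsqrt _ hHg] at hlarge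
    rw [hsqrt _ hHf] at hsmall
    linarith
  have hzero : ∀ K : C(UnitAddTorus ι, ℂ), mFourierCoeff K 0 = ∫ t, K t := by
    intro K
    simp [mFourierCoeff, mFourier_zero]
  have hF0 : mFourierCoeff F' 0 = ∫ t, F t :=
    (hzero F').trans (integral_comp_torusAffine h v F)
  have hsum := (hasSum_prod_mFourierCoeff_continuous F' G).sub_const
    ((starRingEnd ℂ) (∫ t, F t) * ∫ t, G t)
  refine le_of_tendsto hsum.norm ?_
  filter_upwards [Filter.eventually_ge_atTop {0}] with S hS
  rw [← Finset.sum_erase_add _ _ (hS (Finset.mem_singleton_self 0)), hF0, hzero G,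
    add_sub_cancel_right]
  exact hfin _ (Finset.notMem_erase 0 S)

lemma integral_torus_eq_integral_Icc {E : Type*} [NormedAddCommGroup E] [NormedSpace ℝ E]
    (F : UnitAddTorus ι → E) :
    ∫ t, F t = ∫ x in Set.Icc (0 : ι → ℝ) 1, F (fun i => (x i : UnitAddCircle)) := by
  rw [UnitAddTorus.integral_preimage F 0]
  have hset : {x : ι → ℝ | ∀ i, x i ∈ Set.Ioc ((0 : ι → ℝ) i) ((0 : ι → ℝ) i + 1)} =
      Set.univ.pi fun i => Set.Ioc ((0 : ι → ℝ) i) ((1 : ι → ℝ) i) := by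
    ext x
    simp
  rw [hset]
  exact setIntegral_congr_set Measure.univ_pi_Ioc_ae_eq_Icc

lemma coe_mulVec_add [DecidableEq ι] (M : Matrix ι ι ℤ) (w x : ι → ℝ) :
    (fun i => (((M.map (Int.cast : ℤ → ℝ)).mulVec x + w) i : UnitAddCircle)) =
      torusAffine M (fun i => (w i : UnitAddCircle)) (fun i => (x i : UnitAddCircle)) := by
  funext i
  change _ = torusEndo M (fun i => (x i : UnitAddCircle)) i + (w i : UnitAddCircle)
  rw [torusEndo_apply, Pi.add_apply, AddCircle.coe_add, Matrix.mulVec, dotProduct]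
  congr 1
  have : ∀ s : Finset ι, ((∑ j ∈ s, M.map (Int.cast : ℤ → ℝ) i j * x j : ℝ) : UnitAddCircle) =
      ∑ j ∈ s, M i j • (x j : UnitAddCircle) := by
    intro s
    rw [← QuotientAddGroup.mk'_apply, map_sum]
    refine Finset.sum_congr rfl fun j _ => ?_
    rw [Matrix.map_apply, ← zsmul_eq_mul, map_zsmul]
    rfl
  exact this _

lemma continuous_of_holder {f : (ι → ℝ) → ℝ} {H θ : ℝ} (hθ : 0 < θ)
    (hf : ∀ x h : ι → ℝ, h ≠ 0 → |f (x + h) - f x| ≤ H * Real.sqrt (∑ i, h i ^ 2) ^ θ) :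
    Continuous f := by
  refine continuous_iff_continuousAt.2 fun x => ?_
  rw [ContinuousAt, tendsto_iff_dist_tendsto_zero]
  have hlim : Filter.Tendsto (fun y : ι → ℝ => H * Real.sqrt (∑ i, (y - x) i ^ 2) ^ θ)
      (nhds x) (nhds 0) := by
    have : Continuous fun y : ι → ℝ => H * Real.sqrt (∑ i, (y - x) i ^ 2) ^ θ := by
      have h1 : Continuous fun y : ι → ℝ => Real.sqrt (∑ i, (y - x) i ^ 2) := by
        simp only [Pi.sub_apply]
        fun_prop
      exact continuous_const.mul (h1.rpow_const fun _ => Or.inr hθ.le)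
    simpa [Real.zero_rpow hθ.ne'] using this.tendsto x
  refine squeeze_zero (fun _ => dist_nonneg) (fun y => ?_) hlim
  rcases eq_or_ne y x with rfl | hne
  · simp [Real.zero_rpow hθ.ne']
  · simpa [Real.dist_eq] using hf x (y - x) (sub_ne_zero.2 hne)

lemma norm_sub_le_of_holder [DecidableEq ι] {f : (ι → ℝ) → ℝ} {H θ : ℝ} (hθ : 0 < θ)
    (hf : ∀ x h : ι → ℝ, h ≠ 0 → |f (x + h) - f x| ≤ H * Real.sqrt (∑ i, h i ^ 2) ^ θ)
    {F : UnitAddTorus ι → ℝ} (hFf : ∀ x : ι → ℝ, F (fun i => (x i : UnitAddCircle)) = f x)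
    (j : ι) (s : ℝ) (t : UnitAddTorus ι) :
    ‖(F (t + Pi.single j (s : UnitAddCircle)) : ℂ) - F t‖ ≤ H * |s| ^ θ := by
  obtain ⟨x, rfl⟩ : ∃ x : ι → ℝ, (fun i => (x i : UnitAddCircle)) = t := by
    choose x hx using fun i => QuotientAddGroup.mk_surjective (t i)
    exact ⟨x, funext hx⟩
  have hadd : (fun i => (x i : UnitAddCircle)) + Pi.single j (s : UnitAddCircle) =
      fun i => ((x + Pi.single j s : ι → ℝ) i : UnitAddCircle) := by
    funext i
    rcases eq_or_ne i j with rfl | hij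
    · simp
    · simp [hij]
  rw [hadd, hFf, hFf, ← Complex.ofReal_sub, Complex.norm_real, Real.norm_eq_abs]
  rcases eq_or_ne s 0 with rfl | hs
  · simp [Real.zero_rpow hθ.ne']
  · have hsum : ∑ i, (Pi.single j s : ι → ℝ) i ^ 2 = s ^ 2 := by
      rw [Finset.sum_eq_single j (fun i _ hi => by simp [hi]) (by simp), Pi.single_eq_same]
    have := hf x (Pi.single j s) (by simpa using hs)
    rwa [hsum, Real.sqrt_sq_eq_abs] at this

/-- Quantitative decorrelation for `ℤ^n`-periodic Hölder functions under an affine map. -/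
lemma abs_integral_affine_sub_le [DecidableEq ι] {M M' : Matrix ι ι ℤ} (h : M * M' = 1)
    (w : ι → ℝ) {f g : (ι → ℝ) → ℝ} {Hf Hg θ N : ℝ} (hθ : 0 < θ) (hN : 0 < N)
    (hfper : ∀ (x : ι → ℝ) (z : ι → ℤ), f (x + fun i => (z i : ℝ)) = f x)
    (hgper : ∀ (x : ι → ℝ) (z : ι → ℤ), g (x + fun i => (z i : ℝ)) = g x)
    (hfb : ∀ x, |f x| ≤ Hf) (hgb : ∀ x, |g x| ≤ Hg)
    (hf : ∀ x h : ι → ℝ, h ≠ 0 → |f (x + h) - f x| ≤ Hf * Real.sqrt (∑ i, h i ^ 2) ^ θ)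
    (hg : ∀ x h : ι → ℝ, h ≠ 0 → |g (x + h) - g x| ≤ Hg * Real.sqrt (∑ i, h i ^ 2) ^ θ)
    (hexp : ∀ l : ι → ℤ, l ≠ 0 → N ≤ ‖l‖ ∨ N ≤ ‖Matrix.vecMul l M'‖) :
    |(∫ x in Set.Icc (0 : ι → ℝ) 1, f ((M.map (Int.cast : ℤ → ℝ)).mulVec x + w) * g x) -
        (∫ x in Set.Icc (0 : ι → ℝ) 1, f x) * (∫ x in Set.Icc (0 : ι → ℝ) 1, g x)| ≤
      Real.sqrt (Fintype.card ι) * N ^ (-θ) *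
        (Hf * Real.sqrt (∫ x in Set.Icc (0 : ι → ℝ) 1, g x ^ 2) +
          Hg * Real.sqrt (∫ x in Set.Icc (0 : ι → ℝ) 1, f x ^ 2)) := by
  obtain ⟨F, hF⟩ := exists_continuousMap_torus (continuous_of_holder hθ hf) hfper
  obtain ⟨G, hG⟩ := exists_continuousMap_torus (continuous_of_holder hθ hg) hgper
  let ofR : C(ℝ, ℂ) := ⟨Complex.ofReal, Complex.continuous_ofReal⟩
  have key := norm_integral_torusAffine_sub_le h (fun i => (w i : UnitAddCircle)) (ofR.comp F)
    (ofR.comp G) hθ ((abs_nonneg _).trans (hfb 0)) ((abs_nonneg _).trans (hgb 0)) hN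
    (norm_sub_le_of_holder hθ hf hF) (norm_sub_le_of_holder hθ hg hG) hexp
  simp only [integral_torus_eq_integral_Icc, ← coe_mulVec_add, ContinuousMap.comp_apply, hF, hG,
    ofR, ContinuousMap.coe_mk, Complex.conj_ofReal, Complex.norm_real, ← Complex.ofReal_mul,
    integral_complex_ofReal, ← Complex.ofReal_sub, Real.norm_eq_abs, sq_abs] at key
  exact key

end Torus

/-- **Exponential mixing for `ℤ^k`-actions by ergodic affine automorphisms of `𝕋^n`**
(Theorem 4.7).  Let `B : ℤ^k → GL(n, ℤ)` be a group homomorphism (encoded by `B 0 = 1`,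
`B (a+b) = B a * B b`) such that for every nonzero `a` no complex eigenvalue of `B a` is a
root of unity, let `v : ℤ^k → ℝ^n`, and let `τ(a) x = B a · x + v a`.  Then for each
`0 < θ < 1` there are `r > 1` and `C > 0` such that for all `a ∈ ℤ^k` and all
`ℤ^n`-periodic `θ`-Hölder `f, g` (with Hölder norms at most `Hf, Hg`),
`|⟨f ∘ τ(a), g⟩ − ∫f ∫g| ≤ C (Hf ‖g‖₂ + Hg ‖f‖₂) r^{−θ‖a‖}`. -/
theorem exponential_mixing_affine_torus (k n : ℕ) (hk : 1 ≤ k) (hn : 1 ≤ n)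
    (B : (Fin k → ℤ) → Matrix (Fin n) (Fin n) ℤ)
    (hB0 : B 0 = 1) (hBadd : ∀ a b, B (a + b) = B a * B b)
    (herg : ∀ a : Fin k → ℤ, a ≠ 0 → ∀ μ : ℂ,
      (((B a).map (Int.cast : ℤ → ℂ)).charpoly).IsRoot μ →
      ¬ ∃ m : ℕ, 0 < m ∧ μ ^ m = 1)
    (v : (Fin k → ℤ) → (Fin n → ℝ))
    (θ : ℝ) (hθ0 : 0 < θ) (hθ1 : θ < 1) :
    ∃ r > (1 : ℝ), ∃ C > (0 : ℝ), ∀ (a : Fin k → ℤ)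
      (f g : (Fin n → ℝ) → ℝ) (Hf Hg : ℝ),
      (∀ (x : Fin n → ℝ) (z : Fin n → ℤ), f (x + fun i => (z i : ℝ)) = f x) →
      (∀ (x : Fin n → ℝ) (z : Fin n → ℤ), g (x + fun i => (z i : ℝ)) = g x) →
      (∀ x : Fin n → ℝ, |f x| ≤ Hf) →
      (∀ x h : Fin n → ℝ, h ≠ 0 →
        |f (x + h) - f x| ≤ Hf * Real.sqrt (∑ i, h i ^ 2) ^ θ) →
      (∀ x : Fin n → ℝ, |g x| ≤ Hg) →
      (∀ x h : Fin n → ℝ, h ≠ 0 →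
        |g (x + h) - g x| ≤ Hg * Real.sqrt (∑ i, h i ^ 2) ^ θ) →
      |(∫ x in Set.Icc (0 : Fin n → ℝ) 1,
          f (((B a).map (Int.cast : ℤ → ℝ)).mulVec x + v a) * g x) -
        (∫ x in Set.Icc (0 : Fin n → ℝ) 1, f x) *
          (∫ x in Set.Icc (0 : Fin n → ℝ) 1, g x)| ≤
        C * (Hf * Real.sqrt (∫ x in Set.Icc (0 : Fin n → ℝ) 1, g x ^ 2) +
             Hg * Real.sqrt (∫ x in Set.Icc (0 : Fin n → ℝ) 1, f x ^ 2)) *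
          r ^ (-(θ * Real.sqrt (∑ j, (a j : ℝ) ^ 2))) := by
  obtain ⟨ρ, hρ, c, hc, hexp⟩ := exists_exponential_expansion B hB0 hBadd fun a ha h1 =>
    herg a ha 1 h1 ⟨1, one_pos, one_pow 1⟩
  have hρ0 : 0 < ρ := one_pos.trans hρ
  have hn0 : (0 : ℝ) < n := by exact_mod_cast hn
  refine ⟨ρ, hρ, Real.sqrt n * c ^ (-θ), by positivity, ?_⟩
  intro a f g Hf Hg hfper hgper hfb hf hgb hg
  have hinv : B a * B (-a) = 1 := by rw [← hBadd, add_neg_cancel, hB0]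
  have key := abs_integral_affine_sub_le hinv (v a) hθ0
    (N := c * ρ ^ latticeNorm a) (by positivity) hfper hgper hfb hgb hf hg fun l hl => by
      simpa only [latticeNorm_neg] using hexp (-a) l hl
  refine key.trans_eq ?_
  rw [Fintype.card_fin, Real.mul_rpow hc.le (by positivity), ← Real.rpow_mul hρ0.le, latticeNorm,
    mul_neg, mul_comm _ θ]
  ring
end

section
/- Let E be a finite-dimensional real normed vector space, let k ≥ 1, and let f : E → E be a C^k map. Suppose N_1 ≥ 1 and N_k ≥ 1 are constants such that ‖Df(x)‖ ≤ N_1 for all x ∈ E and ‖D^j f(x)‖ ≤ N_k for all x ∈ E and all 1 ≤ j ≤ k, where D^j denotes the j-th iterated Fréchet derivative. Then there exists a polynomial P with nonnegative real coefficients, depending only on k and the dimension of E, such that for every m ≥ 1 and every x ∈ E, ‖D^k(f^{∘m})(x)‖ ≤ N_1^{mk} · P(m · N_k), where f^{∘m} denotes the m-fold composition of f with itself. -/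
open scoped NNReal Nat

/-- Bound on the derivative of order `k + 1` of a composition `g ∘ f` which isolates the only term
involving the derivative of order `k + 1` of `f`. -/
theorem norm_iteratedFDeriv_succ_comp_le {E F G : Type*}
    [NormedAddCommGroup E] [NormedSpace ℝ E] [NormedAddCommGroup F] [NormedSpace ℝ F]
    [NormedAddCommGroup G] [NormedSpace ℝ G] {g : F → G} {f : E → F} {k : ℕ} {N₁ N D : ℝ} {x : E}
    (hg : ContDiff ℝ (k + 1 : ℕ) g) (hf : ContDiff ℝ (k + 1 : ℕ) f)
    (hN₁ : ‖fderiv ℝ g (f x)‖ ≤ N₁)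
    (hN : ∀ j, 1 ≤ j → j ≤ k + 1 → ‖iteratedFDeriv ℝ j g (f x)‖ ≤ N)
    (hD : ∀ j, 1 ≤ j → j ≤ k → ‖iteratedFDeriv ℝ j f x‖ ≤ D ^ j) :
    ‖iteratedFDeriv ℝ (k + 1) (g ∘ f) x‖ ≤ N₁ * ‖iteratedFDeriv ℝ (k + 1) f x‖ +
      (∑ i ∈ Finset.range k, k.choose (i + 1) * (i + 1)! : ℕ) * N * D ^ (k + 1) := by
  have hg' : ContDiff ℝ k (fderiv ℝ g) := hg.fderiv_right (by norm_cast)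
  have hf' : ContDiff ℝ k (fderiv ℝ f) := hf.fderiv_right (by norm_cast)
  have hfk : ContDiff ℝ k f := hf.of_le (by exact_mod_cast k.le_succ)
  have hN0 : 0 ≤ N := (norm_nonneg _).trans (hN 1 le_rfl (by omega))
  have key : ∀ i ∈ Finset.range k,
      (k.choose (i + 1) : ℝ) * ‖iteratedFDeriv ℝ (i + 1) (fderiv ℝ g ∘ f) x‖ *
        ‖iteratedFDeriv ℝ (k - (i + 1)) (fderiv ℝ f) x‖ ≤
      (k.choose (i + 1) * (i + 1)! : ℕ) * (N * D ^ (k + 1)) := by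
    intro i hi
    rw [Finset.mem_range] at hi
    have h₁ : ‖iteratedFDeriv ℝ (i + 1) (fderiv ℝ g ∘ f) x‖ ≤ (i + 1)! * N * D ^ (i + 1) := by
      refine norm_iteratedFDeriv_comp_le hg' hfk (by exact_mod_cast hi) x ?_ ?_
      · intro j hj
        rw [norm_iteratedFDeriv_fderiv]
        exact hN _ (by omega) (by omega)
      · exact fun j hj hj' ↦ hD j hj (by omega)
    have h₂ : ‖iteratedFDeriv ℝ (k - (i + 1)) (fderiv ℝ f) x‖ ≤ D ^ (k - i) := by
      rw [norm_iteratedFDeriv_fderiv, show k - (i + 1) + 1 = k - i by omega]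
      exact hD _ (by omega) (by omega)
    calc _ ≤ (k.choose (i + 1) : ℝ) * ((i + 1)! * N * D ^ (i + 1)) * D ^ (k - i) := by
          gcongr
          exact mul_nonneg (by positivity) ((norm_nonneg _).trans h₁)
      _ = _ := by
          rw [show k + 1 = (i + 1) + (k - i) by omega, pow_add]
          push_cast
          ring
  calc ‖iteratedFDeriv ℝ (k + 1) (g ∘ f) x‖
      = ‖iteratedFDeriv ℝ k (fun y ↦ ContinuousLinearMap.compL ℝ E F G
          ((fderiv ℝ g ∘ f) y) (fderiv ℝ f y)) x‖ := by
        rw [← norm_iteratedFDeriv_fderiv]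
        congr 2
        ext1 y
        exact fderiv_comp y (hg.differentiable (by simp) _) (hf.differentiable (by simp) _)
    _ ≤ ∑ i ∈ Finset.range (k + 1), (k.choose i : ℝ) *
          ‖iteratedFDeriv ℝ i (fderiv ℝ g ∘ f) x‖ * ‖iteratedFDeriv ℝ (k - i) (fderiv ℝ f) x‖ :=
        (ContinuousLinearMap.compL ℝ E F G).norm_iteratedFDeriv_le_of_bilinear_of_le_one
          (hg'.comp hfk) hf' x le_rfl (ContinuousLinearMap.norm_compL_le ℝ E F G)
    _ ≤ _ := by
        rw [Finset.sum_range_succ', add_comm]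
        refine add_le_add ?_ ?_
        · simp only [Nat.choose_zero_right, Nat.cast_one, one_mul, norm_iteratedFDeriv_zero,
            Nat.sub_zero, norm_iteratedFDeriv_fderiv, Function.comp_apply]
          gcongr
        · rw [mul_assoc, Nat.cast_sum, Finset.sum_mul]
          exact Finset.sum_le_sum key

theorem norm_iteratedFDeriv_succ_id_le {E : Type*} [NormedAddCommGroup E] [NormedSpace ℝ E]
    (k : ℕ) (x : E) : ‖iteratedFDeriv ℝ (k + 1) (id : E → E) x‖ ≤ 1 := by
  rw [← norm_iteratedFDeriv_fderiv, show fderiv ℝ (id : E → E) = fun _ ↦ .id ℝ E from funext fun _ ↦ fderiv_id]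
  cases k with
  | zero => simpa using ContinuousLinearMap.norm_id_le
  | succ k => simp [iteratedFDeriv_succ_const]

theorem contDiff_iterate {E : Type*} [NormedAddCommGroup E] [NormedSpace ℝ E] {f : E → E}
    {k : WithTop ℕ∞} (hf : ContDiff ℝ k f) (n : ℕ) : ContDiff ℝ k f^[n] := by
  induction n with
  | zero => exact contDiff_id
  | succ n ih => exact ih.comp hf

/-- If the derivatives of order at most `k` of the first `M` iterates of `f` grow like powers of
`N₁ ^ n * ρ`, then those of order `k + 1` grow like `N₁ ^ (n * (k + 1))` up to a factor which is
affine in `n`. -/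
theorem norm_iteratedFDeriv_succ_iterate_le {E : Type*} [NormedAddCommGroup E] [NormedSpace ℝ E]
    {f : E → E} {k M : ℕ} {N₁ N ρ : ℝ} (hN₁ : 1 ≤ N₁) (hf : ContDiff ℝ (k + 1 : ℕ) f)
    (hfderiv : ∀ x, ‖fderiv ℝ f x‖ ≤ N₁)
    (hN : ∀ j, 1 ≤ j → j ≤ k + 1 → ∀ x, ‖iteratedFDeriv ℝ j f x‖ ≤ N) (hρ : 0 ≤ ρ)
    (h : ∀ n ≤ M, ∀ j, 1 ≤ j → j ≤ k → ∀ x, ‖iteratedFDeriv ℝ j f^[n] x‖ ≤ (N₁ ^ n * ρ) ^ j)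
    (n : ℕ) (hn : n ≤ M) (x : E) :
    ‖iteratedFDeriv ℝ (k + 1) f^[n] x‖ ≤ N₁ ^ (n * (k + 1)) *
      (1 + n * N * (∑ i ∈ Finset.range k, k.choose (i + 1) * (i + 1)! : ℕ) * ρ ^ (k + 1)) := by
  set c : ℝ := ((∑ i ∈ Finset.range k, k.choose (i + 1) * (i + 1)! : ℕ) : ℝ)
  have hc : 0 ≤ c := Nat.cast_nonneg _
  have hN0 : 0 ≤ N := (norm_nonneg _).trans (hN 1 le_rfl (by omega) x)
  induction n with
  | zero => simpa using norm_iteratedFDeriv_succ_id_le k x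
  | succ n ih =>
    rw [Function.iterate_succ']
    calc _ ≤ N₁ * ‖iteratedFDeriv ℝ (k + 1) f^[n] x‖ + c * N * (N₁ ^ n * ρ) ^ (k + 1) :=
          norm_iteratedFDeriv_succ_comp_le hf (contDiff_iterate hf n) (hfderiv _)
            (fun j hj hj' ↦ hN j hj hj' _) (fun j hj hj' ↦ h n (by omega) j hj hj' x)
      _ ≤ N₁ ^ (k + 1) * (N₁ ^ (n * (k + 1)) * (1 + n * N * c * ρ ^ (k + 1))) +
            N₁ ^ (k + 1) * (c * N * (N₁ ^ n * ρ) ^ (k + 1)) := by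
          refine add_le_add ?_ (le_mul_of_one_le_left (by positivity) (one_le_pow₀ hN₁))
          gcongr
          · exact le_self_pow₀ hN₁ (by omega)
          · exact ih (by omega)
      _ = _ := by
          rw [mul_pow, ← pow_mul]
          push_cast
          ring

theorem Polynomial.eval₂_toRealHom_mono (R : Polynomial ℝ≥0) {a b : ℝ} (ha : 0 ≤ a)
    (hab : a ≤ b) :
    R.eval₂ NNReal.toRealHom a ≤ R.eval₂ NNReal.toRealHom b := by
  simp only [Polynomial.eval₂_eq_sum_range, NNReal.coe_toRealHom]
  gcongr

theorem Polynomial.eval₂_toRealHom_nonneg (R : Polynomial ℝ≥0) {a : ℝ} (ha : 0 ≤ a) :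
    0 ≤ R.eval₂ NNReal.toRealHom a := by
  simp only [Polynomial.eval₂_eq_sum_range, NNReal.coe_toRealHom]
  positivity

theorem exists_polynomial_norm_iteratedFDeriv_iterate_le (E : Type*) [NormedAddCommGroup E]
    [NormedSpace ℝ E] (k : ℕ) :
    ∃ R : Polynomial ℝ≥0, ∀ (f : E → E) (N₁ N : ℝ), 1 ≤ N₁ → 0 ≤ N → ContDiff ℝ k f →
      (∀ x, ‖fderiv ℝ f x‖ ≤ N₁) →
      (∀ j, 1 ≤ j → j ≤ k → ∀ x, ‖iteratedFDeriv ℝ j f x‖ ≤ N) →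
      ∀ m j : ℕ, 1 ≤ j → j ≤ k → ∀ x,
        ‖iteratedFDeriv ℝ j f^[m] x‖ ≤ (N₁ ^ m * R.eval₂ NNReal.toRealHom (m * N)) ^ j := by
  induction k with
  | zero => exact ⟨0, by intros; omega⟩
  | succ k ih =>
    obtain ⟨R, hR⟩ := ih
    set c : ℕ := ∑ i ∈ Finset.range k, k.choose (i + 1) * (i + 1)! with hc
    refine ⟨1 + R + Polynomial.X * (c : Polynomial ℝ≥0) * R ^ (k + 1), ?_⟩
    intro f N₁ N hN₁ hN0 hf hfderiv hN m j hj hjk x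
    have hmN : 0 ≤ m * N := by positivity
    have hfk : ContDiff ℝ k f := hf.of_le (by exact_mod_cast k.le_succ)
    have IH := hR f N₁ N hN₁ hN0 hfk hfderiv fun j hj hj' ↦ hN j hj (by omega)
    set ρ := R.eval₂ NNReal.toRealHom (m * N) with hρ_def
    have hρ : 0 ≤ ρ := R.eval₂_toRealHom_nonneg hmN
    simp only [Polynomial.eval₂_add, Polynomial.eval₂_mul, Polynomial.eval₂_pow,
      Polynomial.eval₂_X, Polynomial.eval₂_one, Polynomial.eval₂_natCast, ← hρ_def]
    have htail : 0 ≤ m * N * c * ρ ^ (k + 1) := by positivity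
    rcases hjk.lt_or_eq with hlt | rfl
    · refine (IH m j hj (by omega) x).trans ?_
      gcongr
      linarith
    · refine (norm_iteratedFDeriv_succ_iterate_le hN₁ hf hfderiv hN hρ ?_ m le_rfl x).trans ?_
      · intro n hn j hj hj' x
        refine (IH n j hj hj' x).trans ?_
        have := R.eval₂_toRealHom_nonneg (a := n * N) (by positivity)
        gcongr
        exact R.eval₂_toRealHom_mono (by positivity) (by gcongr)
      · rw [← hc, mul_pow, ← pow_mul]
        gcongr
        calc _ ≤ 1 + ρ + m * N * c * ρ ^ (k + 1) := by linarith
          _ ≤ _ := le_self_pow₀ (by linarith) (by omega)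


/-- **Estimate on compositions** (Lemma 3.6, trivial foliation case).  Let `E` be a
finite-dimensional real normed space and `k ≥ 1`.  There is a polynomial `P` with
nonnegative coefficients, depending only on `k` and `dim E`, such that for every `C^k`
map `f : E → E` with `‖Df(x)‖ ≤ N₁` and `‖D^j f(x)‖ ≤ N_k` for all `x` and `1 ≤ j ≤ k`
(where `N₁, N_k ≥ 1`), the iterates satisfy
`‖D^k (f^m)(x)‖ ≤ N₁^{mk} · P(m · N_k)` for all `m ≥ 1` and all `x`. -/
theorem composition_estimate (E : Type*) [NormedAddCommGroup E] [NormedSpace ℝ E]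
    [FiniteDimensional ℝ E] (k : ℕ) (hk : 1 ≤ k) :
    ∃ P : Polynomial ℝ, (∀ i, 0 ≤ P.coeff i) ∧
      ∀ (f : E → E) (N₁ Nk : ℝ), 1 ≤ N₁ → 1 ≤ Nk →
        ContDiff ℝ (k : ℕ∞) f →
        (∀ x : E, ‖fderiv ℝ f x‖ ≤ N₁) →
        (∀ j : ℕ, 1 ≤ j → j ≤ k → ∀ x : E, ‖iteratedFDeriv ℝ j f x‖ ≤ Nk) →
        ∀ m : ℕ, 1 ≤ m → ∀ x : E,
          ‖iteratedFDeriv ℝ k (f^[m]) x‖ ≤ N₁ ^ (m * k) * P.eval ((m : ℝ) * Nk) := by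
  obtain ⟨R, hR⟩ := exists_polynomial_norm_iteratedFDeriv_iterate_le E k
  refine ⟨(R ^ k).map NNReal.toRealHom, fun i ↦ ?_, ?_⟩
  · rw [Polynomial.coeff_map]
    exact NNReal.coe_nonneg _
  · intro f N₁ Nk hN₁ hNk hf hfderiv hN m _ x
    rw [Polynomial.eval_map, Polynomial.eval₂_pow, pow_mul, ← mul_pow]
    exact hR f N₁ Nk hN₁ (by linarith) hf hfderiv hN m k hk le_rfl x
end

section
/- Let n ≥ 1, let u ∈ L¹(ℝ^n), and let V_1, …, V_r be linear subspaces of ℝ^n with V_1 + ⋯ + V_r = ℝ^n. Assume that for each i ∈ {1,…,r}, every finite sequence of vectors v_1, …, v_m ∈ V_i, and every θ with 0 < θ ≤ 1, there exists a constant C such that | ∫_{ℝ^n} u(z) · (∂_{v_1} ⋯ ∂_{v_m} φ)(z) dz | ≤ C · ‖φ‖_θ for every smooth compactly supported function φ : ℝ^n → ℝ, where ∂_v denotes the directional derivative along v and ‖φ‖_θ = sup_z |φ(z)| + sup_{z, h≠0} |φ(z+h) − φ(z)|/‖h‖^θ. Then u agrees Lebesgue-almost everywhere with a C^∞ function on ℝ^n.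 -/
open MeasureTheory

/-- Directional derivative of a scalar function along the vector `w`. -/
noncomputable def dirDeriv {E : Type*} [NormedAddCommGroup E] [NormedSpace ℝ E]
    (w : E) (φ : E → ℝ) : E → ℝ :=
  fun z => fderiv ℝ φ z w

/-- Iterated directional derivatives along a list of vectors. -/
noncomputable def iterDirDeriv {E : Type*} [NormedAddCommGroup E] [NormedSpace ℝ E] :
    List E → (E → ℝ) → (E → ℝ)
  | [], φ => φ
  | w :: ws, φ => dirDeriv w (iterDirDeriv ws φ)

section DirectionalDerivatives

variable {E : Type*} [NormedAddCommGroup E] [NormedSpace ℝ E]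

theorem ContDiff.dirDeriv {φ : E → ℝ} (hφ : ContDiff ℝ (⊤ : ℕ∞) φ) (w : E) :
    ContDiff ℝ (⊤ : ℕ∞) (dirDeriv w φ) :=
  (hφ.fderiv_right (m := (⊤ : ℕ∞)) (by simp)).clm_apply contDiff_const

theorem HasCompactSupport.dirDeriv {φ : E → ℝ} (hφ : HasCompactSupport φ) (w : E) :
    HasCompactSupport (dirDeriv w φ) :=
  hφ.fderiv_apply (𝕜 := ℝ) w

theorem ContDiff.iterDirDeriv {φ : E → ℝ} (hφ : ContDiff ℝ (⊤ : ℕ∞) φ) (l : List E) :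
    ContDiff ℝ (⊤ : ℕ∞) (iterDirDeriv l φ) := by
  induction l with
  | nil => exact hφ
  | cons w l ih => exact ih.dirDeriv w

theorem HasCompactSupport.iterDirDeriv {φ : E → ℝ} (hφ : HasCompactSupport φ) (l : List E) :
    HasCompactSupport (iterDirDeriv l φ) := by
  induction l with
  | nil => exact hφ
  | cons w l ih => exact ih.dirDeriv w

theorem iterDirDeriv_append_singleton (l : List E) (w : E) (φ : E → ℝ) :
    iterDirDeriv (l ++ [w]) φ = iterDirDeriv l (dirDeriv w φ) := by
  induction l with
  | nil => rfl
  | cons v l ih => simp [iterDirDeriv, ih]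

theorem iterDirDeriv_linear_combination {f g : E → ℝ} (hf : ContDiff ℝ (⊤ : ℕ∞) f)
    (hg : ContDiff ℝ (⊤ : ℕ∞) g) (b c : ℝ) (l : List E) :
    iterDirDeriv l (fun z => b * f z + c * g z) =
      fun z => b * iterDirDeriv l f z + c * iterDirDeriv l g z := by
  induction l with
  | nil => rfl
  | cons w l ih =>
    funext z
    have h1 := ((hf.iterDirDeriv l).differentiable (by simp) z).hasFDerivAt
    have h2 := ((hg.iterDirDeriv l).differentiable (by simp) z).hasFDerivAt
    simp only [iterDirDeriv, dirDeriv, ih]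
    rw [((h1.const_mul b).fun_add (h2.const_mul c)).fderiv]
    simp

/-- A plane wave with phase `ℓ z + a`, truncated by the dilated cutoff `χ (ε • z)`. -/
noncomputable def truncatedWave (χ : E → ℝ) (ℓ : E →L[ℝ] ℝ) (a ε : ℝ) : E → ℝ :=
  fun z => χ (ε • z) * Real.cos (ℓ z + a)

theorem contDiff_truncatedWave {χ : E → ℝ} (hχ : ContDiff ℝ (⊤ : ℕ∞) χ) (ℓ : E →L[ℝ] ℝ)
    (a ε : ℝ) : ContDiff ℝ (⊤ : ℕ∞) (truncatedWave χ ℓ a ε) :=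
  (hχ.comp (contDiff_const_smul ε)).mul (Real.contDiff_cos.comp (ℓ.contDiff.add contDiff_const))

theorem hasCompactSupport_truncatedWave {χ : E → ℝ} (hχ : HasCompactSupport χ) (ℓ : E →L[ℝ] ℝ)
    (a : ℝ) {ε : ℝ} (hε : ε ≠ 0) : HasCompactSupport (truncatedWave χ ℓ a ε) :=
  (hχ.comp_smul hε).mul_right

theorem dirDeriv_truncatedWave {χ : E → ℝ} (hχ : ContDiff ℝ (⊤ : ℕ∞) χ) (ℓ : E →L[ℝ] ℝ)
    (a ε : ℝ) (v : E) :
    dirDeriv v (truncatedWave χ ℓ a ε) = fun z =>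
      ε * truncatedWave (dirDeriv v χ) ℓ a ε z +
        ℓ v * truncatedWave χ ℓ (a + Real.pi / 2) ε z := by
  funext z
  have h1 : HasFDerivAt (fun z : E => χ (ε • z))
      ((fderiv ℝ χ (ε • z)).comp (ε • ContinuousLinearMap.id ℝ E)) z :=
    (hχ.differentiable (by simp) (ε • z)).hasFDerivAt.comp z
      ((hasFDerivAt_id z).const_smul ε)
  have h2 : HasFDerivAt (fun z : E => Real.cos (ℓ z + a)) (-Real.sin (ℓ z + a) • ℓ) z :=
    (ℓ.hasFDerivAt.add_const a).cos
  have h := (h1.mul h2).fderiv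
  unfold dirDeriv truncatedWave
  rw [show (fun z => χ (ε • z) * Real.cos (ℓ z + a)) =
    (fun z => χ (ε • z)) * fun z => Real.cos (ℓ z + a) from rfl, h, ← add_assoc,
    Real.cos_add_pi_div_two]
  simp
  ring

theorem truncatedWave_lipschitz_bound {χ : E → ℝ} {K : NNReal} (hK : LipschitzWith K χ)
    (hχ : ∀ z, |χ z| ≤ 1) (ℓ : E →L[ℝ] ℝ) (a : ℝ) {ε : ℝ} (hε0 : 0 ≤ ε) (hε1 : ε ≤ 1)
    (z h : E) :
    |truncatedWave χ ℓ a ε (z + h) - truncatedWave χ ℓ a ε z| ≤ (K + ‖ℓ‖) * ‖h‖ := by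
  have h1 : |χ (ε • (z + h)) - χ (ε • z)| ≤ K * ‖h‖ := by
    have := hK.dist_le_mul (ε • (z + h)) (ε • z)
    rw [Real.dist_eq, dist_eq_norm, ← smul_sub, add_sub_cancel_left, norm_smul,
      Real.norm_of_nonneg hε0] at this
    refine this.trans ?_
    gcongr
    exact mul_le_of_le_one_left (norm_nonneg _) hε1
  have h2 : |Real.cos (ℓ (z + h) + a) - Real.cos (ℓ z + a)| ≤ ‖ℓ‖ * ‖h‖ := by
    refine (Real.abs_cos_sub_cos_le _ _).trans ?_
    simpa using ℓ.le_opNorm h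
  calc |truncatedWave χ ℓ a ε (z + h) - truncatedWave χ ℓ a ε z|
      = |(χ (ε • (z + h)) - χ (ε • z)) * Real.cos (ℓ (z + h) + a) +
          χ (ε • z) * (Real.cos (ℓ (z + h) + a) - Real.cos (ℓ z + a))| := by
        unfold truncatedWave; ring_nf
    _ ≤ |χ (ε • (z + h)) - χ (ε • z)| * |Real.cos (ℓ (z + h) + a)| +
          |χ (ε • z)| * |Real.cos (ℓ (z + h) + a) - Real.cos (ℓ z + a)| := by
        rw [← abs_mul, ← abs_mul]; exact abs_add_le _ _
    _ ≤ K * ‖h‖ * 1 + 1 * (‖ℓ‖ * ‖h‖) := by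
        gcongr
        · exact Real.abs_cos_le_one _
        · exact hχ _
    _ = (K + ‖ℓ‖) * ‖h‖ := by ring

theorem abs_truncatedWave_le {χ : E → ℝ} {M : ℝ} (hχ : ∀ z, |χ z| ≤ M) (ℓ : E →L[ℝ] ℝ)
    (a ε : ℝ) (z : E) : |truncatedWave χ ℓ a ε z| ≤ M := by
  rw [truncatedWave, abs_mul]
  exact (mul_le_of_le_one_right (abs_nonneg _) (Real.abs_cos_le_one _)).trans (hχ _)

end DirectionalDerivatives

theorem MeasureTheory.Integrable.mul_continuous_hasCompactSupport {X : Type*}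
    [TopologicalSpace X] [SecondCountableTopology X] [MeasurableSpace X] [OpensMeasurableSpace X]
    {μ : Measure X} {u f : X → ℝ}
    (hu : Integrable u μ) (hf : Continuous f) (hfc : HasCompactSupport f) :
    Integrable (fun z => u z * f z) μ := by
  obtain ⟨M, hM⟩ := hfc.exists_bound_of_continuous hf
  exact hu.mul_bdd hf.aestronglyMeasurable (ae_of_all _ hM)

section TruncationLimit

open Filter Topology

variable {E : Type*} [NormedAddCommGroup E] [NormedSpace ℝ E] [FiniteDimensional ℝ E]
  [MeasurableSpace E] [BorelSpace E] {μ : Measure E}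

theorem tendsto_integral_mul_iterDirDeriv_truncatedWave {u : E → ℝ} (hu : Integrable u μ)
    (ℓ : E →L[ℝ] ℝ) (v : E) (m : ℕ) {χ : E → ℝ} (hχ : ContDiff ℝ (⊤ : ℕ∞) χ)
    (hχc : HasCompactSupport χ) (a : ℝ) :
    Tendsto (fun ε => ∫ z, u z * iterDirDeriv (List.replicate m v) (truncatedWave χ ℓ a ε) z ∂μ)
      (𝓝[>] (0 : ℝ))
      (𝓝 (ℓ v ^ m * χ 0 * ∫ z, u z * Real.cos (ℓ z + (a + m * (Real.pi / 2))) ∂μ)) := by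
  induction m generalizing χ a with
  | zero =>
    obtain ⟨M, hM⟩ := hχc.exists_bound_of_continuous hχ.continuous
    simp only [List.replicate_zero, iterDirDeriv, pow_zero, one_mul, Nat.cast_zero, zero_mul,
      add_zero]
    rw [← integral_const_mul]
    refine tendsto_integral_filter_of_dominated_convergence (fun z => ‖u z‖ * M) ?_ ?_
      (hu.norm.mul_const M) ?_
    · exact Eventually.of_forall fun ε => hu.aestronglyMeasurable.mul
        (contDiff_truncatedWave hχ ℓ a ε).continuous.aestronglyMeasurable
    · refine Eventually.of_forall fun ε => ae_of_all _ fun z => ?_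
      rw [norm_mul]
      gcongr
      exact abs_truncatedWave_le hM ℓ a ε z
    · refine ae_of_all _ fun z => tendsto_nhdsWithin_of_tendsto_nhds ?_
      have h : Continuous fun ε : ℝ => u z * truncatedWave χ ℓ a ε z := by
        have := hχ.continuous
        unfold truncatedWave
        fun_prop
      convert h.tendsto 0 using 2
      simp [truncatedWave]
      ring
  | succ m ih =>
    have key : ∀ ε ∈ Set.Ioi (0 : ℝ),
        ε * (∫ z, u z *
          iterDirDeriv (List.replicate m v) (truncatedWave (dirDeriv v χ) ℓ a ε) z ∂μ) +
        ℓ v * (∫ z, u z *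
          iterDirDeriv (List.replicate m v) (truncatedWave χ ℓ (a + Real.pi / 2) ε) z ∂μ) =
        ∫ z, u z * iterDirDeriv (List.replicate (m + 1) v) (truncatedWave χ ℓ a ε) z ∂μ := by
      intro ε hε
      have hint : ∀ (χ' : E → ℝ) (b : ℝ), ContDiff ℝ (⊤ : ℕ∞) χ' → HasCompactSupport χ' →
          Integrable (fun z => u z *
            iterDirDeriv (List.replicate m v) (truncatedWave χ' ℓ b ε) z) μ := fun χ' b h h' =>
        hu.mul_continuous_hasCompactSupport
          ((contDiff_truncatedWave h ℓ b ε).iterDirDeriv _).continuous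
          ((hasCompactSupport_truncatedWave h' ℓ b (ne_of_gt hε)).iterDirDeriv _)
      rw [List.replicate_succ', iterDirDeriv_append_singleton, dirDeriv_truncatedWave hχ,
        iterDirDeriv_linear_combination (contDiff_truncatedWave (hχ.dirDeriv v) _ _ _)
          (contDiff_truncatedWave hχ _ _ _), ← integral_const_mul, ← integral_const_mul,
        ← integral_add ((hint _ _ (hχ.dirDeriv v) (hχc.dirDeriv v)).const_mul _)
          ((hint _ _ hχ hχc).const_mul _)]
      congr 1
      funext z
      ring
    refine Tendsto.congr' (eventually_mem_nhdsWithin.mono key) ?_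
    have hε : Tendsto (fun ε : ℝ => ε) (𝓝[>] 0) (𝓝 0) :=
      tendsto_nhdsWithin_of_tendsto_nhds tendsto_id
    convert (hε.mul (ih (hχ.dirDeriv v) (hχc.dirDeriv v) a)).add
      ((ih hχ hχc (a + Real.pi / 2)).const_mul (ℓ v)) using 2
    rw [zero_mul, zero_add, pow_succ]
    push_cast
    rw [show a + (m + 1) * (Real.pi / 2) = a + Real.pi / 2 + m * (Real.pi / 2) by ring]
    ring

end TruncationLimit

theorem exists_bound_pow_mul_abs_integral_mul_cos {n : ℕ} {u : (Fin n → ℝ) → ℝ}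
    (hu : Integrable u) (v : Fin n → ℝ) (m : ℕ) {C : ℝ}
    (hC : ∀ (φ : (Fin n → ℝ) → ℝ) (H : ℝ),
      ContDiff ℝ (⊤ : ℕ∞) φ → HasCompactSupport φ → (∀ z, |φ z| ≤ H) →
      (∀ z h : Fin n → ℝ, h ≠ 0 →
        |φ (z + h) - φ z| ≤ H * Real.sqrt (∑ j, h j ^ 2) ^ (1 : ℝ)) →
      |∫ z, u z * iterDirDeriv (List.replicate m v) φ z| ≤ C * H) :
    ∃ D : ℝ, 0 ≤ D ∧ ∀ (ℓ : (Fin n → ℝ) →L[ℝ] ℝ) (b : ℝ),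
      |ℓ v| ^ m * |∫ z, u z * Real.cos (ℓ z + b)| ≤ D * (1 + ‖ℓ‖) := by
  let χ : ContDiffBump (0 : Fin n → ℝ) := ⟨1, 2, one_pos, one_lt_two⟩
  have hχ : ContDiff ℝ (⊤ : ℕ∞) χ := χ.contDiff
  have hχ1 : ∀ z, |χ z| ≤ 1 := fun z => by rw [abs_of_nonneg χ.nonneg]; exact χ.le_one
  obtain ⟨K, hK⟩ := hχ.lipschitzWith_of_hasCompactSupport χ.hasCompactSupport (by simp)
  refine ⟨|C| * (1 + K), by positivity, fun ℓ b => ?_⟩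
  have hlim := (tendsto_integral_mul_iterDirDeriv_truncatedWave hu ℓ v m hχ χ.hasCompactSupport
    (b - m * (Real.pi / 2))).abs
  rw [χ.one_of_mem_closedBall (by simp [χ]), mul_one, sub_add_cancel, abs_mul, abs_pow] at hlim
  refine le_of_tendsto hlim ?_
  filter_upwards [Ioc_mem_nhdsGT (zero_lt_one' ℝ)] with ε hε
  refine (hC _ (1 + K + ‖ℓ‖) (contDiff_truncatedWave hχ ℓ _ ε)
    (hasCompactSupport_truncatedWave χ.hasCompactSupport ℓ _ hε.1.ne') (fun z => ?_)
    fun z h _ => ?_).trans ?_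
  · refine (abs_truncatedWave_le hχ1 _ _ _ _).trans ?_
    linarith [K.coe_nonneg, norm_nonneg ℓ]
  · refine (truncatedWave_lipschitz_bound hK hχ1 ℓ _ hε.1.le hε.2 z h).trans ?_
    rw [Real.rpow_one]
    gcongr
    · linarith
    · refine (pi_norm_le_iff_of_nonneg (Real.sqrt_nonneg _)).2 fun j => ?_
      exact Real.abs_le_sqrt (Finset.single_le_sum (f := fun j => h j ^ 2)
        (fun _ _ => sq_nonneg _) (Finset.mem_univ j))
  · have := mul_nonneg K.coe_nonneg (norm_nonneg ℓ)
    calc C * (1 + K + ‖ℓ‖) ≤ |C| * (1 + K + ‖ℓ‖) := by gcongr; exact le_abs_self C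
      _ ≤ |C| * ((1 + K) * (1 + ‖ℓ‖)) := by gcongr; linarith
      _ = |C| * (1 + K) * (1 + ‖ℓ‖) := by ring

section FourierInversion

open FourierTransform SchwartzMap

variable {W F : Type*} [NormedAddCommGroup W] [InnerProductSpace ℝ W] [FiniteDimensional ℝ W]
  [MeasurableSpace W] [BorelSpace W] [NormedAddCommGroup F] [NormedSpace ℂ F]

theorem integral_fourier_smul_eq_of_integrable [CompleteSpace F] {f : W → ℂ} {g : W → F} (hf : Integrable f)
    (hg : Integrable g) : ∫ x, 𝓕 f x • g x = ∫ x, f x • 𝓕 g x := by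
  simpa using! VectorFourier.integral_fourierIntegral_smul_eq_flip (L := innerₗ W)
    Real.continuous_fourierChar continuous_inner hf hg

theorem integral_fourierInv_smul_eq_of_integrable [CompleteSpace F] {f : W → ℂ} {g : W → F} (hf : Integrable f)
    (hg : Integrable g) : ∫ x, 𝓕⁻ f x • g x = ∫ x, f x • 𝓕⁻ g x := by
  rw [Real.fourierInv_eq_fourier_comp_neg, integral_fourier_smul_eq_of_integrable hf.comp_neg hg,
    ← integral_neg_eq_self]
  simp [Real.fourierInv_eq_fourier_neg]

theorem MeasureTheory.Integrable.continuous_fourierInv {f : W → F} (hf : Integrable f) :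
    Continuous (𝓕⁻ f) :=
  VectorFourier.fourierIntegral_continuous Real.continuous_fourierChar
    (L := -innerₗ W) continuous_inner.neg hf

/-- Fourier inversion almost everywhere, without a continuity assumption. -/
theorem MeasureTheory.Integrable.ae_eq_fourierInv_fourier [CompleteSpace F] {f : W → F}
    (hf : Integrable f) (h'f : Integrable (𝓕 f)) : f =ᵐ[volume] 𝓕⁻ (𝓕 f) := by
  refine ae_eq_of_integral_contDiff_smul_eq hf.locallyIntegrable
    h'f.continuous_fourierInv.locallyIntegrable fun g hg hgc => ?_
  let ψ : 𝓢(W, ℂ) := (hgc.comp_left Complex.ofReal_zero).toSchwartzMap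
    (Complex.ofRealCLM.contDiff.comp hg)
  have hψ : ∀ x (y : F), g x • y = ψ x • y := fun x y => (Complex.coe_smul (g x) y).symm
  simp_rw [hψ]
  rw [← integral_fourierInv_smul_eq_of_integrable ψ.integrable h'f, ← SchwartzMap.fourierInv_coe,
    ← integral_fourier_smul_eq_of_integrable (𝓕⁻ ψ).integrable hf, ← SchwartzMap.fourier_coe,
    FourierTransform.fourier_fourierInv_eq]

end FourierInversion

section PowerDomination

variable {α : Type*} {F G p q : α → ℝ}

/-- Every power of `p` times `F` is bounded by a constant multiple of `G`. -/
def PowDominated (F G p : α → ℝ) : Prop :=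
  ∀ m : ℕ, ∃ C : ℝ, ∀ x, |p x| ^ m * F x ≤ C * G x

theorem PowDominated.add (hF : 0 ≤ F) (hp : PowDominated F G p) (hq : PowDominated F G q) :
    PowDominated F G (fun x => p x + q x) := by
  intro m
  obtain ⟨C, hC⟩ := hp m
  obtain ⟨D, hD⟩ := hq m
  refine ⟨2 ^ (m - 1) * (C + D), fun x => ?_⟩
  calc |p x + q x| ^ m * F x
      ≤ (|p x| + |q x|) ^ m * F x := by
        gcongr
        · exact hF x
        · exact abs_add_le _ _
    _ ≤ 2 ^ (m - 1) * (|p x| ^ m + |q x| ^ m) * F x := by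
        gcongr
        · exact hF x
        · exact add_pow_le (abs_nonneg _) (abs_nonneg _) m
    _ = 2 ^ (m - 1) * (|p x| ^ m * F x + |q x| ^ m * F x) := by ring
    _ ≤ 2 ^ (m - 1) * (C * G x + D * G x) := by
        exact mul_le_mul_of_nonneg_left (add_le_add (hC x) (hD x)) (by positivity)
    _ = 2 ^ (m - 1) * (C + D) * G x := by ring

theorem PowDominated.mono (hF : 0 ≤ F) (hq : PowDominated F G q) (h : ∀ x, |p x| ≤ |q x|) :
    PowDominated F G p := by
  intro m
  obtain ⟨C, hC⟩ := hq m
  refine ⟨C, fun x => le_trans ?_ (hC x)⟩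
  exact mul_le_mul_of_nonneg_right (pow_le_pow_left₀ (abs_nonneg _) (h x) m) (hF x)

theorem powDominated_one {C : ℝ} (h : ∀ x, F x ≤ C * G x) : PowDominated F G fun _ => 1 :=
  fun _ => ⟨C, fun x => by simpa using h x⟩

theorem PowDominated.sum {ι : Type*} (s : Finset ι) {p : ι → α → ℝ} (hF : 0 ≤ F)
    (h0 : PowDominated F G fun _ => 1) (h : ∀ i ∈ s, PowDominated F G (p i)) :
    PowDominated F G (fun x => ∑ i ∈ s, p i x) := by
  classical
  induction s using Finset.induction_on with
  | empty => exact h0.mono hF (by simp)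
  | insert i s hi ih =>
    simp_rw [Finset.sum_insert hi]
    exact (h i (by simp)).add hF (ih fun j hj => h j (by simp [hj]))

end PowerDomination

section RapidDecay

open FourierTransform

variable {W F : Type*} [NormedAddCommGroup W] [InnerProductSpace ℝ W] [FiniteDimensional ℝ W]
  [MeasurableSpace W] [BorelSpace W] [NormedAddCommGroup F]

theorem PowDominated.integrable_pow_mul_norm {f : W → F} (hf : Continuous f)
    (h : PowDominated (fun x => ‖f x‖) (fun x => 1 + ‖x‖) fun x => 1 + ‖x‖) (k : ℕ) :
    Integrable fun x => ‖x‖ ^ k * ‖f x‖ := by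
  set d := Module.finrank ℝ W
  obtain ⟨C, hC⟩ := h (k + (d + 2))
  have hint : Integrable fun x : W => C * (1 + ‖x‖) ^ (-(d + 1 : ℝ)) :=
    (integrable_one_add_norm (by simp [d])).const_mul C
  refine hint.mono' (by fun_prop) (ae_of_all _ fun x => ?_)
  have hx : 0 < 1 + ‖x‖ := by positivity
  have hCx := hC x
  rw [abs_of_pos hx] at hCx
  rw [Real.norm_of_nonneg (by positivity), Real.rpow_neg hx.le, ← div_eq_mul_inv,
    show (d + 1 : ℝ) = ((d + 1 : ℕ) : ℝ) by push_cast; rfl, Real.rpow_natCast,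
    le_div_iff₀ (by positivity)]
  refine le_of_mul_le_mul_right ?_ hx
  calc ‖x‖ ^ k * ‖f x‖ * (1 + ‖x‖) ^ (d + 1) * (1 + ‖x‖)
      ≤ (1 + ‖x‖) ^ k * ‖f x‖ * (1 + ‖x‖) ^ (d + 1) * (1 + ‖x‖) := by gcongr; linarith
    _ = (1 + ‖x‖) ^ (k + (d + 2)) * ‖f x‖ := by ring
    _ ≤ C * (1 + ‖x‖) := hCx

variable [NormedSpace ℂ F] [CompleteSpace F]

/-- An integrable function with rapidly decaying Fourier transform is smooth up to a null set. -/
theorem exists_contDiff_ae_eq_of_powDominated_fourier {f : W → F}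
    (hf : Integrable f)
    (h : PowDominated (fun x => ‖𝓕 f x‖) (fun x => 1 + ‖x‖) fun x => 1 + ‖x‖) :
    ∃ g : W → F, ContDiff ℝ (⊤ : ℕ∞) g ∧ f =ᵐ[volume] g := by
  have hcont : Continuous (𝓕 f) := VectorFourier.fourierIntegral_continuous
    Real.continuous_fourierChar (L := innerₗ W) continuous_inner hf
  have hint := h.integrable_pow_mul_norm hcont
  have h0 : Integrable (𝓕 f) := by
    refine (integrable_norm_iff hcont.aestronglyMeasurable).1 ?_
    simpa using hint 0
  refine ⟨𝓕⁻ (𝓕 f), ?_, hf.ae_eq_fourierInv_fourier h0⟩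
  have : 𝓕⁻ (𝓕 f) = fun x => 𝓕 (𝓕 f) (-x) := funext (Real.fourierInv_eq_fourier_neg _)
  rw [this]
  exact (Real.contDiff_fourier fun k _ => hint k).comp contDiff_neg

end RapidDecay

section EuclideanFourier

open FourierTransform WithLp

/-- The real phase `z ↦ -2π ⟨z, ξ⟩` of the Fourier kernel. -/
noncomputable def fourierPhase {n : ℕ} (ξ : EuclideanSpace ℝ (Fin n)) : (Fin n → ℝ) →L[ℝ] ℝ :=
  (-2 * Real.pi) • (innerSL ℝ ξ).comp
    ((EuclideanSpace.equiv (Fin n) ℝ).symm : (Fin n → ℝ) →L[ℝ] EuclideanSpace ℝ (Fin n))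

theorem fourierPhase_apply {n : ℕ} (ξ : EuclideanSpace ℝ (Fin n)) (z : Fin n → ℝ) :
    fourierPhase ξ z = -2 * Real.pi * inner ℝ (toLp 2 z) ξ := by
  rw [real_inner_comm]
  rfl

theorem exists_norm_fourierPhase_le (n : ℕ) :
    ∃ c : ℝ, 0 ≤ c ∧ ∀ ξ : EuclideanSpace ℝ (Fin n), ‖fourierPhase ξ‖ ≤ c * ‖ξ‖ := by
  refine ⟨‖-2 * Real.pi‖ * ‖((EuclideanSpace.equiv (Fin n) ℝ).symm :
    (Fin n → ℝ) →L[ℝ] EuclideanSpace ℝ (Fin n))‖, by positivity, fun ξ => ?_⟩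
  rw [fourierPhase, norm_smul, mul_assoc]
  gcongr
  refine (ContinuousLinearMap.opNorm_comp_le _ _).trans_eq ?_
  rw [innerSL_apply_norm, mul_comm]

theorem norm_fourier_ofReal_le {n : ℕ} {u : (Fin n → ℝ) → ℝ} (hu : Integrable u)
    (ξ : EuclideanSpace ℝ (Fin n)) :
    ‖𝓕 (fun x : EuclideanSpace ℝ (Fin n) => (u (ofLp x) : ℂ)) ξ‖ ≤
      |∫ z, u z * Real.cos (fourierPhase ξ z + 0)| +
        |∫ z, u z * Real.cos (fourierPhase ξ z + -(Real.pi / 2))| := by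
  have hint : ∀ b, Integrable fun z => u z * Real.cos (fourierPhase ξ z + b) := fun b =>
    hu.mul_bdd (c := 1) (by fun_prop) (ae_of_all _ fun z => Real.abs_cos_le_one _)
  have key : 𝓕 (fun x : EuclideanSpace ℝ (Fin n) => (u (ofLp x) : ℂ)) ξ =
      ((∫ z, u z * Real.cos (fourierPhase ξ z + 0) : ℝ) : ℂ) +
        ((∫ z, u z * Real.cos (fourierPhase ξ z + -(Real.pi / 2)) : ℝ) : ℂ) * Complex.I := by
    rw [Real.fourier_eq', ← (PiLp.volume_preserving_toLp (Fin n)).integral_comp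
      (MeasurableEquiv.toLp 2 (Fin n → ℝ)).measurableEmbedding, ← integral_complex_ofReal,
      ← integral_complex_ofReal, ← integral_mul_const,
      ← integral_add (hint _).ofReal ((hint _).ofReal.mul_const _)]
    congr 1
    funext z
    rw [← fourierPhase_apply, Complex.exp_mul_I, ← sub_eq_add_neg (fourierPhase ξ z),
      Real.cos_sub_pi_div_two]
    simp
    ring
  rw [key]
  refine (norm_add_le _ _).trans_eq ?_
  simp

end EuclideanFourier

section SpanningDirections

open FourierTransform WithLp

theorem powDominated_fourierPhase {n : ℕ} {u : (Fin n → ℝ) → ℝ} (hu : Integrable u)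
    (v : Fin n → ℝ)
    (hv : ∀ m : ℕ, ∃ C : ℝ, ∀ (φ : (Fin n → ℝ) → ℝ) (H : ℝ),
      ContDiff ℝ (⊤ : ℕ∞) φ → HasCompactSupport φ → (∀ z, |φ z| ≤ H) →
      (∀ z h : Fin n → ℝ, h ≠ 0 →
        |φ (z + h) - φ z| ≤ H * Real.sqrt (∑ j, h j ^ 2) ^ (1 : ℝ)) →
      |∫ z, u z * iterDirDeriv (List.replicate m v) φ z| ≤ C * H) :
    PowDominated (fun ξ => ‖𝓕 (fun x : EuclideanSpace ℝ (Fin n) => (u (ofLp x) : ℂ)) ξ‖)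
      (fun ξ => 1 + ‖ξ‖) (fun ξ => fourierPhase ξ v) := by
  intro m
  obtain ⟨C, hC⟩ := hv m
  obtain ⟨D, hD0, hD⟩ := exists_bound_pow_mul_abs_integral_mul_cos hu v m hC
  obtain ⟨c, hc0, hc⟩ := exists_norm_fourierPhase_le n
  refine ⟨2 * D * (1 + c), fun ξ => ?_⟩
  have hle : 1 + ‖fourierPhase ξ‖ ≤ (1 + c) * (1 + ‖ξ‖) := by
    linarith [hc ξ, norm_nonneg ξ]
  calc |fourierPhase ξ v| ^ m * ‖𝓕 (fun x : EuclideanSpace ℝ (Fin n) => (u (ofLp x) : ℂ)) ξ‖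
      ≤ |fourierPhase ξ v| ^ m * (|∫ z, u z * Real.cos (fourierPhase ξ z + 0)| +
        |∫ z, u z * Real.cos (fourierPhase ξ z + -(Real.pi / 2))|) := by
        gcongr
        exact norm_fourier_ofReal_le hu ξ
    _ ≤ D * (1 + ‖fourierPhase ξ‖) + D * (1 + ‖fourierPhase ξ‖) := by
        rw [mul_add]
        exact add_le_add (hD _ _) (hD _ _)
    _ = 2 * D * (1 + ‖fourierPhase ξ‖) := by ring
    _ ≤ 2 * D * ((1 + c) * (1 + ‖ξ‖)) := by gcongr
    _ = 2 * D * (1 + c) * (1 + ‖ξ‖) := by ring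

theorem one_add_norm_le_one_add_sum_abs_fourierPhase {n : ℕ} (ξ : EuclideanSpace ℝ (Fin n)) :
    1 + ‖ξ‖ ≤ 1 + ∑ j, |fourierPhase ξ (Pi.single j 1)| := by
  gcongr
  calc ‖ξ‖ = ‖∑ j, ξ j • EuclideanSpace.single j (1 : ℝ)‖ := by
        congr 1
        ext i
        simp [Pi.single_apply]
    _ ≤ ∑ j, ‖ξ j • EuclideanSpace.single j (1 : ℝ)‖ := norm_sum_le _ _
    _ ≤ ∑ j, |fourierPhase ξ (Pi.single j 1)| := by
        gcongr with j
        have h : inner ℝ (toLp 2 (Pi.single j (1 : ℝ))) ξ = ξ j :=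
          (EuclideanSpace.inner_single_left j (1 : ℝ) ξ).trans (by simp)
        rw [fourierPhase_apply, h, norm_smul, PiLp.norm_single, norm_one, mul_one,
          abs_mul, Real.norm_eq_abs]
        refine le_mul_of_one_le_left (abs_nonneg _) ?_
        rw [abs_mul, abs_neg, abs_of_pos Real.pi_pos, abs_two]
        linarith [Real.pi_gt_three]

end SpanningDirections

/-- **Corollary 7.7 for flat foliations.**  Let `u ∈ L¹(ℝ^n)` and let `V₁, …, V_r` be
linear subspaces of `ℝ^n` with `V₁ + ⋯ + V_r = ℝ^n`.  If for each `i`, every iterated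
distributional directional derivative of `u` along vectors of `V_i` is bounded by the
`θ`-Hölder norm of the test function for every `θ ∈ (0, 1]`, then `u` agrees almost
everywhere with a `C^∞` function. -/
theorem smooth_of_holder_dual_derivatives_along_spanning_subspaces
    (n r : ℕ) (hn : 1 ≤ n) (hr : 1 ≤ r)
    (u : (Fin n → ℝ) → ℝ) (hu : Integrable u)
    (V : Fin r → Submodule ℝ (Fin n → ℝ))
    (hspan : (⨆ i, V i) = ⊤)
    (hder : ∀ (i : Fin r) (l : List (Fin n → ℝ)), (∀ w ∈ l, w ∈ V i) →
      ∀ θ : ℝ, 0 < θ → θ ≤ 1 →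
      ∃ C : ℝ, ∀ (φ : (Fin n → ℝ) → ℝ) (H : ℝ),
        ContDiff ℝ (⊤ : ℕ∞) φ → HasCompactSupport φ →
        (∀ z, |φ z| ≤ H) →
        (∀ z h : Fin n → ℝ, h ≠ 0 →
          |φ (z + h) - φ z| ≤ H * Real.sqrt (∑ j, h j ^ 2) ^ θ) →
        |∫ z : Fin n → ℝ, u z * iterDirDeriv l φ z| ≤ C * H) :
    ∃ g : (Fin n → ℝ) → ℝ, ContDiff ℝ (⊤ : ℕ∞) g ∧ u =ᵐ[volume] g := by
  let U : EuclideanSpace ℝ (Fin n) → ℂ := fun x => (u (WithLp.ofLp x) : ℂ)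
  have hU : Integrable U := ((PiLp.volume_preserving_ofLp (Fin n)).integrable_comp_of_integrable
    hu).ofReal
  let A : EuclideanSpace ℝ (Fin n) → ℝ := fun ξ => ‖FourierTransform.fourier U ξ‖
  let G : EuclideanSpace ℝ (Fin n) → ℝ := fun ξ => 1 + ‖ξ‖
  have hA : 0 ≤ A := fun ξ => norm_nonneg _
  have hone : PowDominated A G fun _ => 1 := by
    refine powDominated_one (C := ∫ x, ‖U x‖) fun ξ => ?_
    refine (VectorFourier.norm_fourierIntegral_le_integral_norm _ _ _ _ _).trans ?_
    exact le_mul_of_one_le_right (by positivity) (by simp [G])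
  have hphase : ∀ v, PowDominated A G fun ξ => fourierPhase ξ v := by
    intro v
    refine Submodule.iSup_induction V (x := v) (by rw [hspan]; trivial) (fun i w hw => ?_) ?_
      fun x y hx hy => ?_
    · exact powDominated_fourierPhase hu w fun m => hder i (List.replicate m w)
        (fun x hx => (List.eq_of_mem_replicate hx) ▸ hw) 1 one_pos le_rfl
    · exact hone.mono hA (by simp)
    · simpa using hx.add hA hy
  have hG : PowDominated A G G := by
    refine (hone.add hA (PowDominated.sum Finset.univ hA hone
      fun j _ => (hphase (Pi.single j 1)).mono (p := fun ξ => |fourierPhase ξ (Pi.single j 1)|)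
        hA (by simp))).mono hA fun ξ => ?_
    rw [abs_of_nonneg (by positivity), abs_of_nonneg (by positivity)]
    exact one_add_norm_le_one_add_sum_abs_fourierPhase ξ
  obtain ⟨g, hg, hUg⟩ := exists_contDiff_ae_eq_of_powDominated_fourier hU hG
  refine ⟨fun z => (g (WithLp.toLp 2 z)).re, ?_, ?_⟩
  · exact Complex.reCLM.contDiff.comp (hg.comp (EuclideanSpace.equiv (Fin n) ℝ).symm.contDiff)
  · filter_upwards [(PiLp.volume_preserving_toLp (Fin n)).quasiMeasurePreserving.ae hUg] with z hz
    rw [← hz]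
    rfl
end

section
/- For every group homomorphism B : ℤ² → GL(2,ℤ) there exists a nonzero a ∈ ℤ² such that some complex eigenvalue of B(a) is a root of unity. Equivalently, there is no ℤ²-action by 2×2 integer matrices of determinant ±1 all of whose nontrivial elements act ergodically on the torus 𝕋². -/
/-- A nontrivial finite commutative algebra over an algebraically closed field has a rational
point. -/
theorem nonempty_algHom_of_finite (K S : Type*) [Field K] [IsAlgClosed K] [CommRing S]
    [Nontrivial S] [Algebra K S] [Module.Finite K S] : Nonempty (S →ₐ[K] K) := by
  obtain ⟨M, hM⟩ := Ideal.exists_maximal S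
  let : Field (S ⧸ M) := Ideal.Quotient.field M
  exact ⟨(IsAlgClosed.lift (R := K) (S := S ⧸ M) (M := K)).comp (Ideal.Quotient.mkₐ K M)⟩

open scoped IsMulCommutative in
/-- A commutative monoid in a finite-dimensional algebra over an algebraically closed field has
a character whose values are annihilated by every polynomial annihilating the represented
elements. -/
theorem exists_character_isRoot {K A G : Type*} [Field K] [IsAlgClosed K] [Ring A] [Nontrivial A]
    [Algebra K A] [FiniteDimensional K A] [CommMonoid G] (f : G →* A) :
    ∃ χ : G →* K, ∀ (g : G) (p : Polynomial K), Polynomial.aeval (f g) p = 0 → p.IsRoot (χ g) := by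
  have hcomm : ∀ a ∈ Set.range f, ∀ b ∈ Set.range f, a * b = b * a := by
    rintro _ ⟨g, rfl⟩ _ ⟨h, rfl⟩
    rw [← map_mul, ← map_mul, mul_comm]
  let S : Subalgebra K A := Algebra.adjoin K (Set.range f)
  have : IsMulCommutative S := Algebra.isMulCommutative_adjoin K hcomm
  have : FiniteDimensional K S := inferInstanceAs (FiniteDimensional K S.toSubmodule)
  obtain ⟨φ⟩ := nonempty_algHom_of_finite K S
  let F : G →* S :=
    { toFun := fun g => ⟨f g, Algebra.subset_adjoin ⟨g, rfl⟩⟩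
      map_one' := Subtype.ext (map_one f)
      map_mul' := fun g h => Subtype.ext (map_mul f g h) }
  refine ⟨(φ : S →* K).comp F, fun g p hp => ?_⟩
  have hF : Polynomial.aeval (F g) p = 0 := by
    apply Subtype.ext
    have h := Polynomial.aeval_algHom_apply S.val (F g) p
    exact h.symm.trans hp
  have h := Polynomial.aeval_algHom_apply φ (F g) p
  rw [hF, map_zero, Polynomial.coe_aeval_eq_eval] at h
  exact h

/-- A real-valued homomorphism on `ℤ²` is bounded on an infinite set. -/
theorem exists_infinite_abs_le (L : (Fin 2 → ℤ) →+ ℝ) :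
    ∃ C : ℝ, {a | |L a| ≤ C}.Infinite := by
  have hL : ∀ a, L a = a 0 * L (Pi.single 0 1) + a 1 * L (Pi.single 1 1) := by
    intro a
    have ha : a = a 0 • Pi.single 0 1 + a 1 • Pi.single 1 1 := by
      ext i; fin_cases i <;> simp
    conv_lhs => rw [ha]
    rw [map_add, map_zsmul, map_zsmul, zsmul_eq_mul, zsmul_eq_mul]
  set x := L (Pi.single 0 1)
  set y := L (Pi.single 1 1)
  refine ⟨|y|, ?_⟩
  by_cases hy : y = 0
  · refine Set.infinite_of_injective_forall_mem (f := fun n : ℤ => (![0, n] : Fin 2 → ℤ)) ?_ ?_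
    · intro m n h
      simpa using congrFun h 1
    · intro n
      simp [hL, hy]
  · refine Set.infinite_of_injective_forall_mem
      (f := fun n : ℤ => (![n, -⌊n * x / y⌋] : Fin 2 → ℤ)) ?_ ?_
    · intro m n h
      simpa using congrFun h 0
    · intro n
      have h : L ![n, -⌊n * x / y⌋] = Int.fract (n * x / y) * y := by
        rw [hL, Int.fract, sub_mul, div_mul_cancel₀ _ hy]
        simp [sub_eq_add_neg]
      rw [Set.mem_ofPred_eq, h, abs_mul, Int.abs_fract]
      exact mul_le_of_le_one_left (abs_nonneg y) (Int.fract_lt_one _).le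

/-- Only finitely many nonzero `z : ℂ` with `z` and `z⁻¹` bounded by `C` are roots of a monic
integral quadratic polynomial with constant term `±1`. -/
theorem finite_setOf_quadratic_root (C : ℝ) :
    {z : ℂ | ‖z‖ ≤ C ∧ ‖z⁻¹‖ ≤ C ∧ z ≠ 0 ∧
      ∃ t d : ℤ, IsUnit d ∧ z ^ 2 - t * z + d = 0}.Finite := by
  have hroots : ∀ t d : ℤ, {z : ℂ | z ^ 2 - t * z + d = 0}.Finite := by
    intro t d
    let p : Polynomial ℂ := Polynomial.X ^ 2 - Polynomial.C (t : ℂ) * Polynomial.X +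
      Polynomial.C (d : ℂ)
    have hp : p.Monic := by dsimp only [p]; monicity!
    refine (p.roots.toFinset.finite_toSet).subset fun z hz => ?_
    rw [Finset.mem_coe, Multiset.mem_toFinset, Polynomial.mem_roots hp.ne_zero]
    simpa [p] using hz
  refine ((Set.finite_Icc (-⌈2 * C⌉) ⌈2 * C⌉).biUnion fun t _ =>
    (Set.toFinite ({1, -1} : Set ℤ)).biUnion fun d _ => hroots t d).subset ?_
  rintro z ⟨hz, hz', hz0, t, d, hd, h⟩
  have hd' : ‖(d : ℂ)‖ = 1 := by
    rcases Int.isUnit_iff.mp hd with rfl | rfl <;> simp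
  have ht : (t : ℂ) = z + d * z⁻¹ := by
    field_simp
    linear_combination -h
  have hle : |(t : ℝ)| ≤ 2 * C := by
    calc |(t : ℝ)| = ‖(t : ℂ)‖ := by simp
      _ ≤ ‖z‖ + ‖(d : ℂ) * z⁻¹‖ := ht ▸ norm_add_le _ _
      _ ≤ 2 * C := by rw [norm_mul, hd']; linarith
  have hint : |t| ≤ ⌈2 * C⌉ := by
    have h' := hle.trans (Int.le_ceil (2 * C))
    exact_mod_cast h'
  simp only [Set.mem_iUnion]
  exact ⟨t, abs_le.mp hint, d, Int.isUnit_iff.mp hd, h⟩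


/-- **No higher rank ergodic actions on `𝕋²`.**  For every group homomorphism
`B : ℤ² → GL(2, ℤ)` (encoded by `B 0 = 1` and `B (a + b) = B a * B b`) there is a nonzero
`a ∈ ℤ²` such that some complex eigenvalue of `B a` is a root of unity; equivalently,
there is no `ℤ²`-action by `2 × 2` integer matrices of determinant `±1` all of whose
nontrivial elements act ergodically on `𝕋²`. -/
theorem no_rank_two_ergodic_action_on_torus_two
    (B : (Fin 2 → ℤ) → Matrix (Fin 2) (Fin 2) ℤ)
    (hB0 : B 0 = 1) (hBadd : ∀ a b, B (a + b) = B a * B b) :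
    ∃ a : Fin 2 → ℤ, a ≠ 0 ∧ ∃ μ : ℂ,
      (((B a).map (Int.cast : ℤ → ℂ)).charpoly).IsRoot μ ∧
      ∃ m : ℕ, 0 < m ∧ μ ^ m = 1 := by
  let f : Multiplicative (Fin 2 → ℤ) →* Matrix (Fin 2) (Fin 2) ℂ :=
    (Int.castRingHom ℂ).mapMatrix.toMonoidHom.comp
      { toFun := fun a => B a.toAdd
        map_one' := hB0
        map_mul' := fun a b => hBadd a.toAdd b.toAdd }
  obtain ⟨χ, hχ⟩ := exists_character_isRoot (K := ℂ) f
  have hroot : ∀ a, (((B a).map (Int.cast : ℤ → ℂ)).charpoly).IsRoot (χ (.ofAdd a)) :=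
    fun a => hχ (.ofAdd a) _ (Matrix.aeval_self_charpoly _)
  have hne : ∀ a, χ a ≠ 0 := fun a => ((Group.isUnit a).map χ).ne_zero
  have hdet : ∀ a, IsUnit (B a).det := by
    intro a
    refine .of_mul_eq_one (B (-a)).det ?_
    rw [← Matrix.det_mul, ← hBadd, add_neg_cancel, hB0, Matrix.det_one]
  let L : (Fin 2 → ℤ) →+ ℝ := AddMonoidHom.mk' (fun a => Real.log ‖χ (.ofAdd a)‖) fun a b => by
    rw [ofAdd_add, map_mul, norm_mul, Real.log_mul (norm_ne_zero_iff.mpr (hne _))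
      (norm_ne_zero_iff.mpr (hne _))]
  obtain ⟨C, hC⟩ := exists_infinite_abs_le L
  have hmaps : Set.MapsTo (fun a => χ (.ofAdd a)) {a | |L a| ≤ C}
      {z : ℂ | ‖z‖ ≤ Real.exp C ∧ ‖z⁻¹‖ ≤ Real.exp C ∧ z ≠ 0 ∧
        ∃ t d : ℤ, IsUnit d ∧ z ^ 2 - t * z + d = 0} := by
    intro a ha
    have hpos : 0 < ‖χ (.ofAdd a)‖ := norm_pos_iff.mpr (hne _)
    obtain ⟨hlo, hhi⟩ := abs_le.mp (show |Real.log ‖χ (.ofAdd a)‖| ≤ C from ha)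
    refine ⟨(Real.log_le_iff_le_exp hpos).mp hhi, ?_, hne _, (B a).trace, (B a).det, hdet a, ?_⟩
    · rw [norm_inv]
      refine (Real.log_le_iff_le_exp (inv_pos.mpr hpos)).mp ?_
      rw [Real.log_inv]
      linarith
    · have h := hroot a
      rw [Matrix.charpoly_fin_two] at h
      simpa [Polynomial.IsRoot, Matrix.trace_fin_two, Matrix.det_fin_two] using h
  obtain ⟨a, -, b, -, hab, h⟩ :=
    hC.exists_ne_map_eq_of_mapsTo hmaps (finite_setOf_quadratic_root (Real.exp C))
  refine ⟨a - b, sub_ne_zero.mpr hab, χ (.ofAdd (a - b)), hroot _, 1, one_pos, ?_⟩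
  have hmul : χ (.ofAdd (a - b)) * χ (.ofAdd b) = χ (.ofAdd b) := by
    rw [← map_mul, ← ofAdd_add, sub_add_cancel]
    exact h
  rw [pow_one]
  exact mul_right_cancel₀ (hne _) (hmul.trans (one_mul _).symm)
end
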